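/- arXiv:math/0010052 — 8 statements merged into one kernel-verified Lean document; each statement's English description precedes it below -/
import Mathlib

section
/- Let U ⊆ ℂⁿ be open, A ⊆ U, and let f, g : U → ℂᵖ be differentiable maps. Let 0 < ε < η be constants. Suppose that f is η-transverse to 0 over A, and that ‖g(x) − f(x)‖ ≤ ε and ‖Dg(x) − Df(x)‖ ≤ ε for every x ∈ A. Then g is (η − ε)-transverse to 0 over A. (This is the openness of estimated transversality under C¹-small perturbations.) -/
/-- `f` is `η`-transverse to `0` over `A`: at every point `x ∈ A` with `‖f x‖ ≤ η`,
the real Fréchet derivative is surjective and admits a right inverse of norm `≤ η⁻¹`. -/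
def EtaTransverse {n p : ℕ}
    (f : EuclideanSpace ℂ (Fin n) → EuclideanSpace ℂ (Fin p))
    (A : Set (EuclideanSpace ℂ (Fin n))) (η : ℝ) : Prop :=
  ∀ x ∈ A, ‖f x‖ ≤ η →
    Function.Surjective (fderiv ℝ f x) ∧
    ∃ S : EuclideanSpace ℂ (Fin p) →L[ℝ] EuclideanSpace ℂ (Fin n),
      (fderiv ℝ f x).comp S = ContinuousLinearMap.id ℝ _ ∧ ‖S‖ ≤ η⁻¹

/-- If `S` is a right inverse of `L` with `‖S‖ ≤ η⁻¹`, and `‖M - L‖ ≤ ε < η`, then `M` has a right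
inverse of norm at most `(η - ε)⁻¹`. -/
theorem ContinuousLinearMap.exists_rightInverse_of_norm_sub_le {𝕜 E F : Type*}
    [NontriviallyNormedField 𝕜] [NormedAddCommGroup E] [NormedSpace 𝕜 E]
    [NormedAddCommGroup F] [NormedSpace 𝕜 F] [CompleteSpace F]
    {L M : E →L[𝕜] F} {S : F →L[𝕜] E} {ε η : ℝ} (hε : 0 ≤ ε) (hεη : ε < η)
    (hLS : L.comp S = ContinuousLinearMap.id 𝕜 F) (hS : ‖S‖ ≤ η⁻¹) (hML : ‖M - L‖ ≤ ε) :
    ∃ R : F →L[𝕜] E, M.comp R = ContinuousLinearMap.id 𝕜 F ∧ ‖R‖ ≤ (η - ε)⁻¹ := by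
  have hη : 0 < η := hε.trans_lt hεη
  have hsub : 1 - M.comp S = -((M - L).comp S) := by
    rw [ContinuousLinearMap.sub_comp, hLS, neg_sub]
    rfl
  have hnorm : ‖1 - M.comp S‖ ≤ ε * η⁻¹ := by
    rw [hsub, norm_neg]
    exact (ContinuousLinearMap.opNorm_comp_le _ _).trans
      (mul_le_mul hML hS (norm_nonneg _) hε)
  have hlt : ε * η⁻¹ < 1 := by
    rw [← div_eq_mul_inv]
    exact (div_lt_one hη).2 hεη
  obtain ⟨u, hu⟩ : IsUnit (M.comp S) := by
    have h := (Units.oneSub (1 - M.comp S) (hnorm.trans_lt hlt)).isUnit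
    rwa [Units.val_oneSub, sub_sub_cancel] at h
  set V : F →L[𝕜] F := ↑u⁻¹
  have hV : (M.comp S).comp V = ContinuousLinearMap.id 𝕜 F := by
    rw [← hu]
    exact u.mul_inv
  refine ⟨S.comp V, by rw [← ContinuousLinearMap.comp_assoc, hV],
    ContinuousLinearMap.opNorm_le_bound _ (inv_nonneg.2 (sub_pos.2 hεη).le) fun w => ?_⟩
  have hw : M (S (V w)) = w := DFunLike.congr_fun hV w
  have hVw : ‖V w‖ ≤ ‖w‖ + ε * η⁻¹ * ‖V w‖ := by
    calc ‖V w‖ = ‖w + (1 - M.comp S) (V w)‖ := by simp [hw]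
      _ ≤ ‖w‖ + ‖(1 - M.comp S) (V w)‖ := norm_add_le _ _
      _ ≤ ‖w‖ + ε * η⁻¹ * ‖V w‖ := by
        gcongr
        exact ContinuousLinearMap.le_of_opNorm_le _ hnorm _
  have hSV : ‖S (V w)‖ ≤ η⁻¹ * ‖V w‖ := ContinuousLinearMap.le_of_opNorm_le _ hS _
  calc ‖S (V w)‖ ≤ η⁻¹ * ‖V w‖ := hSV
    _ ≤ (η - ε)⁻¹ * ‖w‖ := by
      rw [le_inv_mul_iff₀ (sub_pos.2 hεη)]
      calc (η - ε) * (η⁻¹ * ‖V w‖) = ‖V w‖ - ε * η⁻¹ * ‖V w‖ := by field_simp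
        _ ≤ ‖w‖ := by linarith

/-- Openness of estimated transversality under `C¹`-small perturbations: if `f` is
`η`-transverse to `0` over `A` and `g` is `ε`-close to `f` in `C¹` norm on `A`
with `ε < η`, then `g` is `(η - ε)`-transverse to `0` over `A`. -/
theorem eta_transverse_open (n p : ℕ) (U : Set (EuclideanSpace ℂ (Fin n)))
    (hU : IsOpen U) (A : Set (EuclideanSpace ℂ (Fin n))) (hA : A ⊆ U)
    (f g : EuclideanSpace ℂ (Fin n) → EuclideanSpace ℂ (Fin p))
    (hf : DifferentiableOn ℝ f U) (hg : DifferentiableOn ℝ g U)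
    (ε η : ℝ) (hε : 0 < ε) (hεη : ε < η)
    (htrans : EtaTransverse f A η)
    (hclose : ∀ x ∈ A, ‖g x - f x‖ ≤ ε)
    (hclose' : ∀ x ∈ A, ‖fderiv ℝ g x - fderiv ℝ f x‖ ≤ ε) :
    EtaTransverse g A (η - ε) := by
  intro x hx hgx
  have hfx : ‖f x‖ ≤ η := by
    have h := norm_le_norm_add_norm_sub' (f x) (g x)
    rw [norm_sub_rev] at h
    linarith [hclose x hx]
  obtain ⟨-, S, hS, hSn⟩ := htrans x hx hfx
  obtain ⟨R, hR, hRn⟩ := ContinuousLinearMap.exists_rightInverse_of_norm_sub_le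
    hε.le hεη hS hSn (hclose' x hx)
  exact ⟨fun w => ⟨R w, DFunLike.congr_fun hR w⟩, R, hR, hRn⟩
end

section
/- Let p ≥ 1, C ≥ 1 and β > 0. There exists a constant c > 0, depending only on p, C and β, with the following property. Let U ⊆ ℂⁿ be open and let θ₁, …, θ_p : U → ℂᵖ be differentiable maps with ‖θᵢ(x)‖ ≤ C and ‖Dθᵢ(x)‖ ≤ C for all x ∈ U and all i, such that the p×p complex matrix with columns θ₁(x), …, θ_p(x) has |det| ≥ β for every x ∈ U. If g = (g₁, …, g_p) : U → ℂᵖ is differentiable and η-transverse to 0 over a subset A ⊆ U for some η > 0, then the map f := Σᵢ gᵢ·θᵢ is cη-transverse to 0 over A. (Estimated transversality is preserved, up to a constant factor, when a function is expressed in a uniformly bounded frame with determinant bounded below.) -/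
open Matrix in
/-- A frame of `ℂᵖ` with vectors of norm at most `C` and determinant at least `β` in absolute
value has a coordinate map of norm at most `p * (p * (β⁻¹ * (p! * C ^ p)))`. -/
lemma exists_frame_coordinates {p : ℕ} {C β : ℝ} (hC : 1 ≤ C) (hβ : 0 < β)
    (a : Fin p → EuclideanSpace ℂ (Fin p)) (ha : ∀ j, ‖a j‖ ≤ C)
    (hdet : β ≤ ‖(Matrix.of fun i j => a j i).det‖) :
    ∃ T : EuclideanSpace ℂ (Fin p) →L[ℝ] EuclideanSpace ℂ (Fin p),
      ‖T‖ ≤ p * (p * (β⁻¹ * (p.factorial * C ^ p))) ∧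
      (∀ w, ∑ j, T w j • a j = w) ∧ ∀ v, T (∑ j, v j • a j) = v := by
  set M : Matrix (Fin p) (Fin p) ℂ := Matrix.of fun i j => a j i with hM
  have hdet_pos : 0 < ‖M.det‖ := hβ.trans_le hdet
  have hunit : IsUnit M.det := isUnit_iff_ne_zero.2 (norm_pos_iff.1 hdet_pos)
  have hentry : ∀ i j, ‖M i j‖ ≤ C := fun i j => (PiLp.norm_apply_le (a j) i).trans (ha j)
  have hadj : ∀ i j, ‖M.adjugate i j‖ ≤ p.factorial * C ^ p := by
    intro i j
    rw [adjugate_apply]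
    have h := Matrix.det_le (A := M.updateRow j (Pi.single i 1))
      (abv := NormedField.toAbsoluteValue ℂ) (x := C) ?_
    · simpa [NormedField.toAbsoluteValue] using h
    · intro k l
      change ‖M.updateRow j (Pi.single i 1) k l‖ ≤ C
      rw [updateRow_apply]
      split_ifs
      · rw [Pi.single_apply]
        split_ifs
        · simpa using hC
        · simpa using zero_le_one.trans hC
      · exact hentry k l
  have hinv : ∀ i j, ‖M⁻¹ i j‖ ≤ β⁻¹ * (p.factorial * C ^ p) := by
    intro i j
    rw [Matrix.inv_def, Matrix.smul_apply, Ring.inverse_eq_inv', smul_eq_mul, norm_mul, norm_inv]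
    gcongr
    exact hadj i j
  have hcomb : ∀ v : EuclideanSpace ℂ (Fin p), ∑ j, v j • a j = WithLp.toLp 2 (M *ᵥ v.ofLp) := by
    intro v
    ext i
    simp [hM, mulVec, dotProduct, mul_comm]
  set B := β⁻¹ * (p.factorial * C ^ p) with hB
  have hB0 : 0 ≤ B := by positivity
  have hbound : ∀ w : EuclideanSpace ℂ (Fin p),
      ‖(WithLp.toLp 2 (M⁻¹ *ᵥ w.ofLp) : EuclideanSpace ℂ (Fin p))‖ ≤ p * (p * B) * ‖w‖ := by
    intro w
    have hcoord : ∀ i, ‖(M⁻¹ *ᵥ w.ofLp) i‖ ≤ p * B * ‖w‖ := by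
      intro i
      calc ‖∑ j, M⁻¹ i j * w j‖ ≤ ∑ j : Fin p, B * ‖w‖ := by
            refine norm_sum_le_of_le _ fun j _ => ?_
            rw [norm_mul]
            exact mul_le_mul (hinv i j) (PiLp.norm_apply_le w j) (norm_nonneg _) hB0
        _ = p * B * ‖w‖ := by simp [mul_assoc]
    set v : EuclideanSpace ℂ (Fin p) := WithLp.toLp 2 (M⁻¹ *ᵥ w.ofLp) with hv
    calc ‖v‖ = ‖∑ i, EuclideanSpace.single i (v i)‖ := by
          congr 1
          ext k
          simp [Pi.single_apply]
      _ ≤ ∑ i : Fin p, p * B * ‖w‖ := by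
          refine norm_sum_le_of_le _ fun i _ => ?_
          rw [PiLp.norm_single]
          exact hcoord i
      _ = p * (p * B) * ‖w‖ := by simp [mul_assoc]
  let L : EuclideanSpace ℂ (Fin p) →ₗ[ℝ] EuclideanSpace ℂ (Fin p) :=
    { toFun := fun w => WithLp.toLp 2 (M⁻¹ *ᵥ w.ofLp)
      map_add' := fun v w => by simp [mulVec_add]
      map_smul' := fun r w => by simp [mulVec_smul] }
  refine ⟨L.mkContinuous _ hbound, L.mkContinuous_norm_le (by positivity) hbound, ?_, ?_⟩
  · intro w
    rw [hcomb]
    change WithLp.toLp 2 (M *ᵥ (M⁻¹ *ᵥ w.ofLp)) = w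
    rw [mulVec_mulVec, mul_nonsing_inv M hunit, one_mulVec]
  · intro v
    rw [hcomb]
    change WithLp.toLp 2 (M⁻¹ *ᵥ (M *ᵥ v.ofLp)) = v
    rw [mulVec_mulVec, nonsing_inv_mul M hunit, one_mulVec]

/-- An approximate right inverse of a continuous linear map can be corrected to a right inverse,
at the cost of doubling its norm. -/
lemma ContinuousLinearMap.exists_rightInverse_of_norm_comp_sub_id_le
    {E F : Type*} [NormedAddCommGroup E] [NormedSpace ℝ E]
    [NormedAddCommGroup F] [NormedSpace ℝ F] [CompleteSpace F]
    (L : E →L[ℝ] F) (R : F →L[ℝ] E)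
    (h : ‖L.comp R - ContinuousLinearMap.id ℝ F‖ ≤ 1 / 2) :
    ∃ S : F →L[ℝ] E, L.comp S = ContinuousLinearMap.id ℝ F ∧ ‖S‖ ≤ 2 * ‖R‖ := by
  set t : F →L[ℝ] F := ContinuousLinearMap.id ℝ F - L.comp R with ht
  have htn : ‖t‖ ≤ 1 / 2 := by rwa [ht, norm_sub_rev]
  obtain ⟨u, hu⟩ := isUnit_one_sub_of_norm_lt_one (htn.trans_lt (by norm_num))
  set V : F →L[ℝ] F := ↑u⁻¹ with hV
  have hLR : L.comp R = ↑u := by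
    rw [hu, ht]
    exact (sub_sub_cancel _ _).symm
  have hinv : (L.comp R).comp V = ContinuousLinearMap.id ℝ F := by
    rw [hLR]
    exact u.mul_inv
  have hVn : ‖V‖ ≤ 2 := by
    have hVt : V = ContinuousLinearMap.id ℝ F + t.comp V := by
      rw [ht, ContinuousLinearMap.sub_comp, hinv, ContinuousLinearMap.id_comp]
      abel
    have h1 : ‖V‖ ≤ 1 + 1 / 2 * ‖V‖ := by
      calc ‖V‖ = ‖ContinuousLinearMap.id ℝ F + t.comp V‖ := by rw [← hVt]
        _ ≤ ‖ContinuousLinearMap.id ℝ F‖ + ‖t.comp V‖ := norm_add_le _ _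
        _ ≤ 1 + 1 / 2 * ‖V‖ := by
          gcongr
          · exact ContinuousLinearMap.norm_id_le
          · exact (t.opNorm_comp_le V).trans (by gcongr)
    linarith
  refine ⟨R.comp V, by rw [← ContinuousLinearMap.comp_assoc, hinv], ?_⟩
  calc ‖R.comp V‖ ≤ ‖R‖ * ‖V‖ := R.opNorm_comp_le V
    _ ≤ ‖R‖ * 2 := by gcongr
    _ = 2 * ‖R‖ := mul_comm _ _

/-- The Leibniz rule for a combination `∑ i, g i • θ i` of vector fields. -/
lemma fderiv_sum_smul_apply {n p : ℕ}
    {θ : Fin p → EuclideanSpace ℂ (Fin n) → EuclideanSpace ℂ (Fin p)}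
    {g : EuclideanSpace ℂ (Fin n) → EuclideanSpace ℂ (Fin p)} {x : EuclideanSpace ℂ (Fin n)}
    (hθ : ∀ i, DifferentiableAt ℝ (θ i) x) (hg : DifferentiableAt ℝ g x)
    (v : EuclideanSpace ℂ (Fin n)) :
    fderiv ℝ (fun y => ∑ i, g y i • θ i y) x v =
      ∑ i, fderiv ℝ g x v i • θ i x + ∑ i, g x i • fderiv ℝ (θ i) x v := by
  have hgi : ∀ i, HasFDerivAt (fun y => g y i)
      (((EuclideanSpace.proj i : EuclideanSpace ℂ (Fin p) →L[ℂ] ℂ).restrictScalars ℝ).comp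
        (fderiv ℝ g x)) x := fun i =>
    ((EuclideanSpace.proj i : EuclideanSpace ℂ (Fin p) →L[ℂ] ℂ).restrictScalars
      ℝ).hasFDerivAt.comp x hg.hasFDerivAt
  have h := HasFDerivAt.fun_sum (u := Finset.univ)
    fun i _ => (hgi i).fun_smul (hθ i).hasFDerivAt
  rw [h.fderiv, ← Finset.sum_add_distrib]
  simp [add_comm]

/-- Estimated transversality is preserved, up to a constant factor depending only on
`p`, `C` and `β`, when a function is expressed in a uniformly bounded frame
`θ₁, …, θ_p` whose determinant is bounded below by `β`. -/
theorem eta_transverse_frame (p : ℕ) (hp : 1 ≤ p) (C β : ℝ) (hC : 1 ≤ C) (hβ : 0 < β) :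
    ∃ c : ℝ, 0 < c ∧
      ∀ (n : ℕ) (U : Set (EuclideanSpace ℂ (Fin n))), IsOpen U →
        ∀ θ : Fin p → EuclideanSpace ℂ (Fin n) → EuclideanSpace ℂ (Fin p),
          (∀ i, DifferentiableOn ℝ (θ i) U) →
          (∀ i, ∀ x ∈ U, ‖θ i x‖ ≤ C) →
          (∀ i, ∀ x ∈ U, ‖fderiv ℝ (θ i) x‖ ≤ C) →
          (∀ x ∈ U, β ≤ ‖(Matrix.of fun i j => θ j x i).det‖) →
          ∀ g : EuclideanSpace ℂ (Fin n) → EuclideanSpace ℂ (Fin p),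
            DifferentiableOn ℝ g U →
            ∀ (A : Set (EuclideanSpace ℂ (Fin n))), A ⊆ U →
              ∀ η : ℝ, 0 < η → EtaTransverse g A η →
                EtaTransverse (fun x => ∑ i, g x i • θ i x) A (c * η) := by
  set K : ℝ := p * (p * (β⁻¹ * (p.factorial * C ^ p))) with hK
  have hp0 : (0 : ℝ) < p := by exact_mod_cast hp
  have hC0 : 0 < C := zero_lt_one.trans_le hC
  have hK0 : 0 < K := by positivity
  set c : ℝ := (2 * K + 2 * p * C * K ^ 2)⁻¹ with hc
  have hc0 : 0 < c := by positivity
  have hcK : c * (2 * K + 2 * p * C * K ^ 2) = 1 := inv_mul_cancel₀ (by positivity)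
  have hc1 : 2 * K * c ≤ 1 := by
    have : 0 ≤ c * (2 * p * C * K ^ 2) := by positivity
    linarith
  have hc2 : p * C * K ^ 2 * c ≤ 1 / 2 := by
    have : 0 ≤ c * (2 * K) := by positivity
    linarith
  refine ⟨c, hc0, ?_⟩
  intro n U hU θ hθ hθC hDθ hdet g hg A hA η hη htrans x hx hfx
  have hxU := hA hx
  have hθx : ∀ i, DifferentiableAt ℝ (θ i) x :=
    fun i => (hθ i).differentiableAt (hU.mem_nhds hxU)
  have hgx : DifferentiableAt ℝ g x := hg.differentiableAt (hU.mem_nhds hxU)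
  obtain ⟨T, hTn, hT, hT'⟩ := exists_frame_coordinates hC hβ (fun j => θ j x)
    (fun j => hθC j x hxU) (hdet x hxU)
  have hgn : ‖g x‖ ≤ K * (c * η) := by
    calc ‖g x‖ = ‖T (∑ i, g x i • θ i x)‖ := by rw [hT']
      _ ≤ K * (c * η) := T.le_of_opNorm_le_of_le hTn hfx
  have hgη : ‖g x‖ ≤ η := by
    refine hgn.trans ?_
    have h1 : K * c ≤ 1 := by nlinarith [mul_pos hK0 hc0]
    nlinarith
  obtain ⟨-, S, hS, hSn⟩ := htrans x hx hgη
  have hR : ‖S.comp T‖ ≤ η⁻¹ * K :=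
    (S.opNorm_comp_le T).trans (by gcongr)
  obtain ⟨S', hS', hSn'⟩ :=
    ContinuousLinearMap.exists_rightInverse_of_norm_comp_sub_id_le
      (fderiv ℝ (fun y => ∑ i, g y i • θ i y) x) (S.comp T) <| by
        refine ContinuousLinearMap.opNorm_le_bound _ (by norm_num) fun w => ?_
        have hDg : fderiv ℝ g x (S (T w)) = T w := DFunLike.congr_fun hS (T w)
        have herr : (((fderiv ℝ (fun y => ∑ i, g y i • θ i y) x).comp (S.comp T)) -
            ContinuousLinearMap.id ℝ (EuclideanSpace ℂ (Fin p))) w = ∑ i, g x i • fderiv ℝ (θ i) x (S (T w)) := by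
          simp only [_root_.sub_apply, ContinuousLinearMap.comp_apply,
            ContinuousLinearMap.id_apply]
          rw [fderiv_sum_smul_apply hθx hgx, hDg, hT, add_sub_cancel_left]
        rw [herr]
        calc ‖∑ i, g x i • fderiv ℝ (θ i) x (S (T w))‖
            ≤ ∑ i : Fin p, K * (c * η) * (C * (η⁻¹ * K * ‖w‖)) := by
              refine norm_sum_le_of_le _ fun i _ => ?_
              rw [norm_smul]
              refine mul_le_mul ((PiLp.norm_apply_le (g x) i).trans hgn) ?_
                (norm_nonneg _) (by positivity)
              exact (fderiv ℝ (θ i) x).le_of_opNorm_le_of_le (hDθ i x hxU)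
                ((S.comp T).le_of_opNorm_le hR w)
          _ = p * C * K ^ 2 * c * ‖w‖ := by
              simp only [Finset.sum_const, Finset.card_univ, Fintype.card_fin, nsmul_eq_mul]
              field_simp
          _ ≤ 1 / 2 * ‖w‖ := by gcongr
  refine ⟨fun w => ⟨S' w, DFunLike.congr_fun hS' w⟩, S', hS', hSn'.trans ?_⟩
  calc 2 * ‖S.comp T‖ ≤ 2 * (η⁻¹ * K) := by gcongr
    _ = 2 * K * η⁻¹ := by ring
    _ ≤ c⁻¹ * η⁻¹ := by
      gcongr
      rwa [le_inv_comm₀ (by positivity) hc0, ← one_div, le_div_iff₀ (by positivity), mul_comm]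
    _ = (c * η)⁻¹ := (mul_inv c η).symm
end

section
/- Let U, V ⊆ ℂⁿ be open, L ≥ 0, and let φ : U → V be a differentiable map such that for every x ∈ U the real Fréchet derivative Dφ(x) is invertible with ‖Dφ(x)⁻¹‖ ≤ L. Let A ⊆ U and suppose f : V → ℂᵖ is differentiable and η-transverse to 0 over φ(A) for some η > 0. Then f ∘ φ is η′-transverse to 0 over A, where η′ = η / max(1, L). (Estimated transversality is preserved, with controlled loss of constants, under composition with a coordinate change whose inverse derivative is bounded.) -/
/-- Estimated transversality is preserved, with controlled loss of constants, under
composition with a coordinate change `φ` whose inverse derivative is bounded by `L`: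
if `f` is `η`-transverse to `0` over `φ(A)`, then `f ∘ φ` is `η / max 1 L`-transverse
to `0` over `A`. -/
theorem eta_transverse_coordinate_change (n p : ℕ)
    (U V : Set (EuclideanSpace ℂ (Fin n))) (hU : IsOpen U) (hV : IsOpen V)
    (L : ℝ) (hL : 0 ≤ L)
    (φ : EuclideanSpace ℂ (Fin n) → EuclideanSpace ℂ (Fin n))
    (hφV : Set.MapsTo φ U V) (hφ : DifferentiableOn ℝ φ U)
    (hφinv : ∀ x ∈ U, ∃ T : EuclideanSpace ℂ (Fin n) →L[ℝ] EuclideanSpace ℂ (Fin n),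
      (fderiv ℝ φ x).comp T = ContinuousLinearMap.id ℝ _ ∧
      T.comp (fderiv ℝ φ x) = ContinuousLinearMap.id ℝ _ ∧ ‖T‖ ≤ L)
    (A : Set (EuclideanSpace ℂ (Fin n))) (hA : A ⊆ U)
    (f : EuclideanSpace ℂ (Fin n) → EuclideanSpace ℂ (Fin p))
    (hf : DifferentiableOn ℝ f V)
    (η : ℝ) (hη : 0 < η) (htrans : EtaTransverse f (φ '' A) η) :
    EtaTransverse (f ∘ φ) A (η / max 1 L) := by
  intro x hx hfx
  have hmax : (1 : ℝ) ≤ max 1 L := le_max_left 1 L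
  obtain ⟨-, S, hS, hSη⟩ := htrans (φ x) (Set.mem_image_of_mem φ hx)
    (hfx.trans (div_le_self hη.le hmax))
  obtain ⟨T, hT, -, hTL⟩ := hφinv x (hA hx)
  have hchain : fderiv ℝ (f ∘ φ) x = (fderiv ℝ f (φ x)).comp (fderiv ℝ φ x) :=
    fderiv_comp x (hf.differentiableAt (hV.mem_nhds (hφV (hA hx))))
      (hφ.differentiableAt (hU.mem_nhds (hA hx)))
  have hright : (fderiv ℝ (f ∘ φ) x).comp (T.comp S) = ContinuousLinearMap.id ℝ _ := by
    rw [hchain, ContinuousLinearMap.comp_assoc, ← ContinuousLinearMap.comp_assoc _ T S, hT,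
      ContinuousLinearMap.id_comp, hS]
  refine ⟨fun y => ⟨T (S y), DFunLike.congr_fun hright y⟩, T.comp S, hright, ?_⟩
  calc ‖T.comp S‖ ≤ ‖T‖ * ‖S‖ := T.opNorm_comp_le S
    _ ≤ max 1 L * η⁻¹ := by
      gcongr
      exact hTL.trans (le_max_right 1 L)
    _ = (η / max 1 L)⁻¹ := by rw [inv_div, div_eq_mul_inv]
end

section
/- There exist constants ε₀ > 0 and K > 0, depending only on n and C, with the following property. In the taming setup below, if ε ≤ ε₀ then there exists a linear map J̃ : V → V with J̃² = −id, ω(J̃u, J̃v) = ω(u, v) for all u, v ∈ V, ω(v, J̃v) > 0 for all v ≠ 0 (i.e. J̃ is compatible with ω), and ‖J̃ − J‖ ≤ Kε, where ‖·‖ is the operator norm induced by the inner product. (This is the pointwise, quantitative form of the statement that a taming almost-complex structure can be deformed by O(ε) into a compatible one when the non-(1,1) part of ω is of size ε.) -/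
open scoped RealInnerProductSpace

/-- A positive definite symmetric operator on a finite-dimensional real inner product space has a
symmetric inverse fourth root which is a polynomial in the operator. -/
lemma exists_isSymmetric_aeval_pow_four_mul_eq_one
    {E : Type*} [NormedAddCommGroup E] [InnerProductSpace ℝ E] [FiniteDimensional ℝ E]
    {X : E →ₗ[ℝ] E} (hX : X.IsSymmetric) (hpos : ∀ v, v ≠ 0 → 0 < ⟪X v, v⟫) :
    ∃ p : Polynomial ℝ, (Polynomial.aeval X p).IsSymmetric ∧
      Polynomial.aeval X p ^ 4 * X = 1 := by
  classical
  let b := hX.eigenvectorBasis rfl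
  let l : Fin (Module.finrank ℝ E) → ℝ := hX.eigenvalues rfl
  have hb (i) : X (b i) = l i • b i := hX.apply_eigenvectorBasis rfl i
  have hl (i) : 0 < l i := by
    have h := hpos (b i) (b.orthonormal.ne_zero i)
    rw [hb, inner_smul_left, real_inner_self_eq_norm_sq, b.orthonormal.1 i] at h
    simpa using h
  let f : ℝ → ℝ := fun x ↦ (√√x)⁻¹
  let p := Lagrange.interpolate (Finset.univ.image l) id f
  have hp (i) : p.eval (l i) = f (l i) :=
    Lagrange.eval_interpolate_at_node (v := id) f (Set.injOn_id _)
      (Finset.mem_image_of_mem l (Finset.mem_univ i))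
  have hpb (i) : Polynomial.aeval X p (b i) = f (l i) • b i := by
    rw [Module.End.aeval_apply_of_hasEigenvector (μ := l i)
      ⟨Module.End.mem_eigenspace_iff.2 (hb i), b.orthonormal.ne_zero i⟩, hp]
  refine ⟨p, ?_, b.toBasis.ext fun i ↦ ?_⟩
  · intro u v
    clear_value p
    clear hp hpb
    induction p using Polynomial.induction_on' generalizing u v with
    | add p q hp hq => simp [inner_add_left, inner_add_right, hp, hq]
    | monomial n a =>
      simp [Polynomial.aeval_monomial, inner_smul_left, inner_smul_right, (hX.pow n) u v]
  · have hf : f (l i) ^ 4 * l i = 1 := by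
      have h : √√(l i) ^ 4 = l i := by
        rw [show √√(l i) ^ 4 = (√√(l i) ^ 2) ^ 2 by ring, Real.sq_sqrt (Real.sqrt_nonneg _),
          Real.sq_sqrt (hl i).le]
      simp only [f, inv_pow, h]
      exact inv_mul_cancel₀ (hl i).ne'
    have h : (Polynomial.aeval X p ^ 4 * X) (b i) = (f (l i) ^ 4 * l i) • b i := by
      simp only [Module.End.mul_apply, pow_succ, pow_zero, Module.End.one_apply, hb, map_smul,
        hpb, smul_smul]
      congr 1
      ring
    simpa [hf] using h

/-- The orthogonal part of the polar decomposition of an injective skew operator. -/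
lemma exists_complex_structure_of_skew
    {E : Type*} [NormedAddCommGroup E] [InnerProductSpace ℝ E] [FiniteDimensional ℝ E]
    {A : E →ₗ[ℝ] E} (hA : ∀ u v, ⟪A u, v⟫ = -⟪u, A v⟫) (hinj : ∀ v, A v = 0 → v = 0) :
    ∃ T : E →ₗ[ℝ] E, (∀ v, T (T v) = -v) ∧ (∀ u v, ⟪T u, T v⟫ = ⟪u, v⟫) ∧
      (∀ v, A (T v) = T (A v)) ∧ (∀ v, v ≠ 0 → 0 < ⟪A v, T v⟫) ∧
      ∀ v, ‖T v - A v‖ ≤ ‖v + A (A v)‖ := by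
  have hX : (-(A * A)).IsSymmetric := fun u v ↦ by
    simp [hA]
  obtain ⟨p, hQ, hQX⟩ := exists_isSymmetric_aeval_pow_four_mul_eq_one hX fun v hv ↦ by
    have : 0 < ⟪A v, A v⟫ := real_inner_self_pos.2 fun h ↦ hv (hinj v h)
    simpa [hA (A v) v] using this
  have hAX : Commute A (-(A * A)) := ((Commute.refl A).mul_right (Commute.refl A)).neg_right
  have hcomm : Commute A (Polynomial.aeval (-(A * A)) p) :=
    Polynomial.induction_on' (motive := fun p ↦ Commute A (Polynomial.aeval (-(A * A)) p)) p
      (fun p q hp hq ↦ by simpa using hp.add_right hq)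
      (fun n a ↦ by
        rw [Polynomial.aeval_monomial]
        exact (Algebra.commute_algebraMap_right a A).mul_right (hAX.pow_right n))
  generalize Polynomial.aeval (-(A * A)) p = Q at hQ hQX hcomm
  have hQA (v) : Q (A v) = A (Q v) := (LinearMap.congr_fun hcomm.eq v).symm
  have hQ4 (v) : A (A (Q (Q (Q (Q v))))) = -v := by
    have h := LinearMap.congr_fun hQX v
    simp only [pow_succ, pow_zero, one_mul, Module.End.mul_apply, LinearMap.neg_apply, map_neg,
      hQA, Module.End.one_apply] at h
    rw [← neg_eq_iff_eq_neg, h]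
  have hQinj (v) (h : Q v = 0) : v = 0 := by simpa [h] using (hQ4 v).symm
  have hQ' (u v) : ⟪Q u, v⟫ = ⟪u, Q v⟫ := hQ u v
  have horth (u v) : ⟪A (Q (Q u)), A (Q (Q v))⟫ = ⟪u, v⟫ := by
    rw [hA, hQ', hQ', ← hQA, ← hQA, ← hQA, ← hQA]
    simp only [hQA, hQ4, inner_neg_right, neg_neg]
  refine ⟨A * Q * Q, fun v ↦ ?_, horth, fun v ↦ ?_, fun v hv ↦ ?_, fun v ↦ ?_⟩
  · simp only [Module.End.mul_apply, hQA, hQ4]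
  · simp only [Module.End.mul_apply, hQA]
  · simp only [Module.End.mul_apply]
    rw [← hQA, ← hQ', hQA]
    exact real_inner_self_pos.2 fun h ↦ hv (hQinj v (hinj _ h))
  · -- with `S = -A² Q²` we have `A = T S`, `S² = -A²` and `S ≥ 0`
    set w := v + A (A (Q (Q v))) with hw
    have h1 : (A * Q * Q) v - A v = (A * Q * Q) w := by
      simp only [Module.End.mul_apply, hw, map_add, hQA, hQ4, map_neg]
      abel
    have h2 : v + A (A v) = w - A (A (Q (Q w))) := by
      simp only [hw, map_add, hQA, hQ4, map_neg]
      abel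
    have h3 : ‖(A * Q * Q) w‖ = ‖w‖ := by
      rw [norm_eq_sqrt_real_inner, norm_eq_sqrt_real_inner w]
      exact congrArg _ (horth w w)
    have h4 : ⟪w, A (A (Q (Q w)))⟫ = -⟪A (Q w), A (Q w)⟫ := by
      simp only [hA, hQ', hQA, neg_neg]
    rw [h1, h2, h3]
    refine le_of_sq_le_sq ?_ (norm_nonneg _)
    rw [norm_sub_sq_real, h4, real_inner_self_eq_norm_sq]
    nlinarith [sq_nonneg ‖A (Q w)‖, sq_nonneg ‖A (A (Q (Q w)))‖]

/-- A skew operator close to an orthogonal complex structure has polar part close to it. -/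
lemma exists_complex_structure_of_skew_near
    {E : Type*} [NormedAddCommGroup E] [InnerProductSpace ℝ E] [FiniteDimensional ℝ E]
    {J A : E →ₗ[ℝ] E} (hJ : ∀ v, J (J v) = -v) (hJn : ∀ v, ‖J v‖ = ‖v‖)
    (hA : ∀ u v, ⟪A u, v⟫ = -⟪u, A v⟫) (hinj : ∀ v, A v = 0 → v = 0)
    {ε : ℝ} (hε : 0 ≤ ε) (hε1 : ε ≤ 1) (hAJ : ∀ v, ‖A v - J v‖ ≤ ε * ‖v‖) :
    ∃ T : E →ₗ[ℝ] E, (∀ v, T (T v) = -v) ∧ (∀ u v, ⟪A (T u), T v⟫ = ⟪A u, v⟫) ∧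
      (∀ v, v ≠ 0 → 0 < ⟪A v, T v⟫) ∧ ∀ v, ‖T v - J v‖ ≤ 4 * ε * ‖v‖ := by
  obtain ⟨T, hT, hTo, hTA, hTpos, hTn⟩ := exists_complex_structure_of_skew hA hinj
  refine ⟨T, hT, fun u v ↦ by rw [hTA, hTo], hTpos, fun v ↦ ?_⟩
  have h1 : ‖A v‖ ≤ 2 * ‖v‖ := by
    have := norm_add_le (A v - J v) (J v)
    rw [sub_add_cancel, hJn] at this
    nlinarith [hAJ v, norm_nonneg v]
  have h2 : ‖v + A (A v)‖ ≤ 3 * ε * ‖v‖ := by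
    have h : v + A (A v) = (A (A v) - J (A v)) + J (A v - J v) := by
      rw [map_sub, hJ]; abel
    have h3 := norm_add_le (A (A v) - J (A v)) (J (A v - J v))
    rw [← h, hJn] at h3
    nlinarith [hAJ v, hAJ (A v), mul_le_mul_of_nonneg_left h1 hε]
  have h3 := norm_add_le (T v - A v) (A v - J v)
  rw [sub_add_sub_cancel] at h3
  linarith [hTn v, hAJ v]

/-- Deformation to a compatible complex structure when the taming form
`v ↦ ω v (J v)` is the squared norm. -/
lemma exists_compatible_of_inner_self_eq
    {E : Type*} [NormedAddCommGroup E] [InnerProductSpace ℝ E] [FiniteDimensional ℝ E]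
    {J : E →ₗ[ℝ] E} (hJ : ∀ v, J (J v) = -v) {ω : E →ₗ[ℝ] E →ₗ[ℝ] ℝ}
    (hω : ∀ u v, ω u v = -ω v u) (hinner : ∀ u v, ⟪u, v⟫ = (ω u (J v) + ω v (J u)) / 2)
    {ε : ℝ} (hε : 0 ≤ ε) (hε1 : ε ≤ 1)
    (hbound : ∀ u v, |ω u v - ω (J u) (J v)| ≤ 2 * ε * (‖u‖ * ‖v‖)) :
    ∃ T : E →ₗ[ℝ] E, (∀ v, T (T v) = -v) ∧ (∀ u v, ω (T u) (T v) = ω u v) ∧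
      (∀ v, v ≠ 0 → 0 < ω v (T v)) ∧ ∀ v, ‖T v - J v‖ ≤ 4 * ε * ‖v‖ := by
  let a : E → E := fun u ↦
    (InnerProductSpace.toDual ℝ E).symm (LinearMap.toContinuousLinearMap (ω u))
  have ha (u v) : ⟪a u, v⟫ = ω u v := by simp [a]
  let A : E →ₗ[ℝ] E :=
    { toFun := a
      map_add' := fun u v ↦ ext_inner_right ℝ fun w ↦ by simp [ha, inner_add_left]
      map_smul' := fun c u ↦ ext_inner_right ℝ fun w ↦ by simp [ha, inner_smul_left] }
  have hA (u v) : ⟪A u, v⟫ = ω u v := ha u v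
  have hJo (u v) : ⟪J u, J v⟫ = ⟪u, v⟫ := by
    rw [hinner, hinner, hJ, hJ, map_neg, map_neg, hω u, hω v]
    ring
  have hAJ (v) : ‖A v - J v‖ ≤ ε * ‖v‖ := by
    have h (w) : ⟪A v - J v, w⟫ = (ω v w - ω (J v) (J w)) / 2 := by
      rw [inner_sub_left, hA, hinner, hJ, map_neg, hω w]
      ring
    have h1 := (le_abs_self _).trans (hbound v (A v - J v))
    have h2 := h (A v - J v)
    rw [real_inner_self_eq_norm_sq] at h2
    by_contra! hlt
    have : 0 < ‖A v - J v‖ := lt_of_le_of_lt (by positivity) hlt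
    nlinarith
  obtain ⟨T, hT, hTω, hTpos, hTn⟩ := exists_complex_structure_of_skew_near (A := A) hJ
    (fun v ↦ by rw [norm_eq_sqrt_real_inner, hJo, ← norm_eq_sqrt_real_inner])
    (fun u v ↦ by rw [real_inner_comm, real_inner_comm, hA, real_inner_comm, hA, hω])
    (fun v hv ↦ by
      have h (w) : ω v w = 0 := by rw [← hA, hv, inner_zero_left]
      rw [← inner_self_eq_zero (𝕜 := ℝ), hinner, h]; norm_num) hε hε1 hAJ
  exact ⟨T, hT, fun u v ↦ by rw [← hA, hTω, hA], fun v hv ↦ by rw [← hA]; exact hTpos v hv, hTn⟩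

/-- Deformation to a compatible complex structure, measured in the taming form. -/
lemma exists_compatible_of_taming
    {V : Type*} [AddCommGroup V] [Module ℝ V] [FiniteDimensional ℝ V]
    {J : V →ₗ[ℝ] V} (hJ : ∀ v, J (J v) = -v) {ω : V →ₗ[ℝ] V →ₗ[ℝ] ℝ}
    (hω : ∀ u v, ω u v = -ω v u) (hpos : ∀ v, v ≠ 0 → 0 < ω v (J v))
    {ε : ℝ} (hε : 0 ≤ ε) (hε1 : ε ≤ 1)
    (hbound : ∀ u v, |ω u v - ω (J u) (J v)| ≤ 2 * ε * (√(ω u (J u)) * √(ω v (J v)))) :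
    ∃ T : V →ₗ[ℝ] V, (∀ v, T (T v) = -v) ∧ (∀ u v, ω (T u) (T v) = ω u v) ∧
      (∀ v, v ≠ 0 → 0 < ω v (T v)) ∧
      ∀ v, √(ω (T v - J v) (J (T v - J v))) ≤ 4 * ε * √(ω v (J v)) := by
  have hnonneg (v) : 0 ≤ ω v (J v) := by
    by_cases hv : v = 0
    · simp [hv]
    · exact (hpos v hv).le
  let core : InnerProductSpace.Core ℝ V :=
    { inner := fun u v ↦ (ω u (J v) + ω v (J u)) / 2
      conj_inner_symm := fun u v ↦ by simp [add_comm]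
      re_inner_nonneg := fun v ↦ by simpa using hnonneg v
      add_left := fun u v w ↦ by simp; ring
      smul_left := fun u v r ↦ by simp; ring
      definite := fun v hv ↦ by
        by_contra h
        have := hpos v h
        simp only [add_self_div_two] at hv
        exact this.ne' hv }
  let _ : NormedAddCommGroup V := core.toNormedAddCommGroup
  let _ : InnerProductSpace ℝ V := InnerProductSpace.ofCore core.toCore
  have hinner (u v : V) : ⟪u, v⟫ = (ω u (J v) + ω v (J u)) / 2 := rfl
  have hnorm (v : V) : ‖v‖ = √(ω v (J v)) := by
    rw [norm_eq_sqrt_real_inner, hinner, add_self_div_two]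
  simp only [← hnorm] at hbound ⊢
  exact exists_compatible_of_inner_self_eq hJ hω hinner hε hε1 hbound


/-- Pointwise quantitative taming-to-compatible deformation: if `J` tames `ω` with
bounds `C`, and the non-(1,1) part of `ω` with respect to `J` is of size `ε ≤ ε₀(n,C)`,
then there is an `ω`-compatible complex structure `J̃` with `‖J̃ - J‖ ≤ K(n,C)·ε`. -/
theorem compatible_acs_near_taming (n : ℕ) (hn : 1 ≤ n) (C : ℝ) (hC : 1 ≤ C) :
    ∃ ε₀ : ℝ, 0 < ε₀ ∧ ∃ K : ℝ, 0 < K ∧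
      ∀ (V : Type) [NormedAddCommGroup V] [InnerProductSpace ℝ V]
        [FiniteDimensional ℝ V], Module.finrank ℝ V = 2 * n →
        ∀ J : V →L[ℝ] V, (∀ v, J (J v) = -v) →
          (∀ u v : V, ⟪J u, J v⟫ = ⟪u, v⟫) →
          ∀ ω : V →ₗ[ℝ] V →ₗ[ℝ] ℝ, (∀ u v, ω u v = - ω v u) →
            (∀ v, ‖v‖ ^ 2 ≤ ω v (J v)) →
            (∀ u v, |ω u v| ≤ C * ‖u‖ * ‖v‖) →
            ∀ ε : ℝ, 0 ≤ ε → ε ≤ ε₀ →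
              (∀ u v, |ω u v - ω (J u) (J v)| ≤ 2 * ε * ‖u‖ * ‖v‖) →
              ∃ Jt : V →L[ℝ] V, (∀ v, Jt (Jt v) = -v) ∧
                (∀ u v, ω (Jt u) (Jt v) = ω u v) ∧
                (∀ v, v ≠ 0 → 0 < ω v (Jt v)) ∧
                ‖Jt - J‖ ≤ K * ε := by
  refine ⟨1, one_pos, 4 * C, by positivity, ?_⟩
  intro V _ _ _ _ J hJ hJo ω hω htame hC' ε hε hε1 hbound
  have hle (v : V) : ‖v‖ ≤ √(ω v (J v)) := Real.le_sqrt_of_sq_le (htame v)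
  have hge (v : V) : √(ω v (J v)) ≤ C * ‖v‖ := by
    have hJn : ‖J v‖ = ‖v‖ := by
      rw [norm_eq_sqrt_real_inner, hJo, ← norm_eq_sqrt_real_inner]
    refine Real.sqrt_le_iff.2 ⟨by positivity, ?_⟩
    have h := (le_abs_self _).trans (hC' v (J v))
    rw [hJn] at h
    nlinarith [mul_nonneg (mul_nonneg (sub_nonneg.2 hC) (zero_le_one.trans hC)) (sq_nonneg ‖v‖)]
  obtain ⟨T, hT, hTω, hTpos, hTn⟩ := exists_compatible_of_taming (J := J.toLinearMap) hJ hω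
    (fun v hv ↦ lt_of_lt_of_le (by positivity) (htame v)) hε hε1
    (fun u v ↦ (hbound u v).trans (by
      rw [mul_assoc]
      exact mul_le_mul_of_nonneg_left
        (mul_le_mul (hle u) (hle v) (norm_nonneg v) (Real.sqrt_nonneg _)) (by positivity)))
  refine ⟨LinearMap.toContinuousLinearMap T, hT, hTω, hTpos,
    ContinuousLinearMap.opNorm_le_bound _ (by positivity) fun v ↦ ?_⟩
  calc ‖T v - J v‖ ≤ 4 * ε * √(ω v (J v)) := (hle _).trans (hTn v)
    _ ≤ 4 * ε * (C * ‖v‖) := mul_le_mul_of_nonneg_left (hge v) (by positivity)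
    _ = 4 * C * ε * ‖v‖ := by ring
end

section
/- There exist constants ε₀ > 0 and K > 0, depending only on n and C, with the following property. In the taming setup below, if ε ≤ ε₀ then there exists a basis e₁, e′₁, …, e_n, e′_n of V such that: ‖eᵢ‖ = 1 for all i; ω(eᵢ, eⱼ) = 0 and ω(e′ᵢ, e′ⱼ) = 0 for all i, j; ω(eᵢ, e′ⱼ) = 0 whenever i ≠ j; ω(eᵢ, e′ᵢ) ≥ 1 for all i; and ‖e′ᵢ − J eᵢ‖ ≤ Kε for all i. (Quantitative symplectic Gram–Schmidt: ω admits a symplectic-type basis in which the second family of vectors differs from the J-rotation of the first by O(ε).) -/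
open scoped RealInnerProductSpace

open Module

/-- A symmetric bilinear form on a finite-dimensional Euclidean space is diagonal in some
orthonormal basis. -/
theorem exists_orthonormalBasis_diagonalizing {E : Type*} [NormedAddCommGroup E]
    [InnerProductSpace ℝ E] [FiniteDimensional ℝ E] {n : ℕ} (hn : finrank ℝ E = n)
    (s : E →ₗ[ℝ] E →ₗ[ℝ] ℝ) (hs : ∀ u v, s u v = s v u) :
    ∃ b : OrthonormalBasis (Fin n) ℝ E, ∀ i j, i ≠ j → s (b i) (b j) = 0 := by
  let T : E →ₗ[ℝ] E := (InnerProductSpace.toDual ℝ E).symm.toLinearEquiv.toLinearMap ∘ₗ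
    (LinearMap.toContinuousLinearMap (𝕜 := ℝ) (E := E) (F' := ℝ)).toLinearMap ∘ₗ s
  have hT : ∀ u v, ⟪T u, v⟫ = s u v := fun u v => by
    simp [T]
  have hsymm : T.IsSymmetric := fun u v => by
    rw [hT, real_inner_comm, hT, hs]
  refine ⟨hsymm.eigenvectorBasis hn, fun i j hij => ?_⟩
  rw [← hT, hsymm.apply_eigenvectorBasis, real_inner_smul_left,
    (hsymm.eigenvectorBasis hn).inner_eq_zero hij, mul_zero]

/-- An alternating form on a `2n`-dimensional space has isotropic subspaces of every dimension
up to `n`. -/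
theorem exists_isotropic_of_finrank_eq_two_mul {V : Type*} [AddCommGroup V] [Module ℝ V]
    [FiniteDimensional ℝ V] {n : ℕ} (hV : finrank ℝ V = 2 * n) (ω : V →ₗ[ℝ] V →ₗ[ℝ] ℝ)
    (hω : ∀ u v, ω u v = -ω v u) {k : ℕ} (hk : k ≤ n) :
    ∃ L : Submodule ℝ V, finrank ℝ L = k ∧ ∀ u ∈ L, ∀ v ∈ L, ω u v = 0 := by
  induction k with
  | zero =>
    refine ⟨⊥, finrank_bot ℝ V, ?_⟩
    simp
  | succ k ih =>
    obtain ⟨L, hL, hiso⟩ := ih (by omega)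
    let f : V →ₗ[ℝ] Dual ℝ L := (LinearMap.lcomp ℝ ℝ L.subtype) ∘ₗ ω
    have hf : ∀ v, ∀ u : L, f v u = ω v u := fun v u => rfl
    have hlt : finrank ℝ L < finrank ℝ (LinearMap.ker f) := by
      have h1 := f.finrank_range_add_finrank_ker
      have h2 := Submodule.finrank_le (LinearMap.range f)
      rw [Subspace.dual_finrank_eq] at h2
      omega
    obtain ⟨v, hv, hvL⟩ : ∃ v ∈ LinearMap.ker f, v ∉ L := by
      by_contra! h
      exact absurd (Submodule.finrank_mono (show LinearMap.ker f ≤ L from h)) (by omega)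
    have hvω : ∀ u ∈ L, ω v u = 0 := fun u hu => by
      rw [← hf v ⟨u, hu⟩, LinearMap.mem_ker.1 hv, LinearMap.zero_apply]
    have hvv : ω v v = 0 := by linarith [hω v v]
    have hv0 : v ≠ 0 := fun h => hvL (h ▸ L.zero_mem)
    refine ⟨L ⊔ ℝ ∙ v, ?_, ?_⟩
    · have h := Submodule.finrank_sup_add_finrank_inf_eq L (ℝ ∙ v)
      have hd : L ⊓ ℝ ∙ v = ⊥ := by
        rw [← disjoint_iff]
        exact (Submodule.disjoint_span_singleton' hv0).2 hvL
      rw [hd, finrank_bot, finrank_span_singleton hv0, hL] at h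
      omega
    · intro x hx y hy
      obtain ⟨x₁, hx₁, x₂, hx₂, rfl⟩ := Submodule.mem_sup.1 hx
      obtain ⟨y₁, hy₁, y₂, hy₂, rfl⟩ := Submodule.mem_sup.1 hy
      obtain ⟨a, rfl⟩ := Submodule.mem_span_singleton.1 hx₂
      obtain ⟨c, rfl⟩ := Submodule.mem_span_singleton.1 hy₂
      have hv' : ω x₁ v = 0 := by rw [hω, hvω _ hx₁, neg_zero]
      simp [hiso _ hx₁ _ hy₁, hvω _ hy₁, hv', hvv]

/-- Vectors that pair under `ω` as a rescaled symplectic basis are linearly independent. -/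
theorem linearIndependent_sumElim_of_symplectic {V ι : Type*} [AddCommGroup V] [Module ℝ V]
    [Fintype ι] (ω : V →ₗ[ℝ] V →ₗ[ℝ] ℝ) (e e' : ι → V)
    (hee : ∀ i j, ω (e i) (e j) = 0) (hee'' : ∀ i j, ω (e' i) (e' j) = 0)
    (hee' : ∀ i j, i ≠ j → ω (e i) (e' j) = 0) (hne : ∀ i, ω (e i) (e' i) ≠ 0) :
    LinearIndependent ℝ (Sum.elim e e') := by
  classical
  rw [Fintype.linearIndependent_iff]
  intro g hg
  rw [Fintype.sum_sum_type] at hg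
  simp only [Sum.elim_inl, Sum.elim_inr] at hg
  rintro (j | j)
  · have h := congrArg (fun v => ω v (e' j)) hg
    simp only [map_add, map_sum, map_smul, LinearMap.add_apply, LinearMap.sum_apply,
      LinearMap.smul_apply, hee'', smul_eq_mul, mul_zero, Finset.sum_const_zero, add_zero,
      map_zero, LinearMap.zero_apply] at h
    rw [Finset.sum_eq_single j (fun i _ hij => by rw [hee' i j hij, mul_zero])
      (fun h => absurd (Finset.mem_univ j) h)] at h
    exact (mul_eq_zero.1 h).resolve_right (hne j)
  · have h := congrArg (fun v => ω (e j) v) hg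
    simp only [map_add, map_sum, map_smul, hee, smul_eq_mul, mul_zero, Finset.sum_const_zero,
      zero_add, map_zero] at h
    rw [Finset.sum_eq_single j (fun i _ hij => by rw [hee' j i hij.symm, mul_zero])
      (fun h => absurd (Finset.mem_univ j) h)] at h
    exact (mul_eq_zero.1 h).resolve_right (hne j)

/-- A form `b` with `‖v‖² ≤ b v v` on a Euclidean space, whose off-diagonal entries in an
orthonormal basis are at most `ε`: the vectors `v j` with `b (e i) (v j)` equal to the diagonal
part of `b` are within `nε` of the basis vectors. -/
theorem exists_dual_basis_near {E : Type*} [NormedAddCommGroup E] [InnerProductSpace ℝ E]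
    {n : ℕ} (e : OrthonormalBasis (Fin n) ℝ E) (b : E →ₗ[ℝ] E →ₗ[ℝ] ℝ)
    (hb : ∀ v, ‖v‖ ^ 2 ≤ b v v) {ε : ℝ} (hε : 0 ≤ ε)
    (hoff : ∀ i j, i ≠ j → |b (e i) (e j)| ≤ ε) :
    ∃ v : Fin n → E, (∀ i, b (e i) (v i) = b (e i) (e i)) ∧
      (∀ i j, i ≠ j → b (e i) (v j) = 0) ∧ ∀ j, ‖v j - e j‖ ≤ n * ε := by
  classical
  have : FiniteDimensional ℝ E := e.toBasis.finiteDimensional_of_finite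
  have hinj : Function.Injective b.flip := by
    rw [← LinearMap.ker_eq_bot, LinearMap.ker_eq_bot']
    intro v hv
    have h := hb v
    rw [← LinearMap.flip_apply, hv, LinearMap.zero_apply] at h
    exact norm_eq_zero.1 (pow_eq_zero_iff two_ne_zero |>.1 (le_antisymm h (sq_nonneg _)))
  have hsurj : Function.Surjective b.flip :=
    (LinearMap.injective_iff_surjective_of_finrank_eq_finrank
      (Subspace.dual_finrank_eq (K := ℝ) (V := E)).symm).1 hinj
  choose v hv using fun j =>
    hsurj (e.toBasis.constr ℝ fun i => if i = j then b (e i) (e i) else 0)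
  have hv' : ∀ i j, b (e i) (v j) = if i = j then b (e i) (e i) else 0 := fun i j => by
    have h := congrArg (fun φ => φ (e.toBasis i)) (hv j)
    rwa [Basis.constr_basis, OrthonormalBasis.coe_toBasis] at h
  refine ⟨v, fun i => by simp [hv'], fun i j hij => by simp [hv', hij], fun j => ?_⟩
  set w := v j - e j with hw
  have hbw : ∀ i, |b (e i) w| ≤ ε := fun i => by
    rw [hw, map_sub, hv']
    split_ifs with h
    · subst h
      simpa using hε
    · simpa using hoff i j h
  have h1 : b w w ≤ n * ε * ‖w‖ := by
    calc b w w = b (∑ i, ⟪e i, w⟫ • e i) w := by rw [e.sum_repr']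
      _ = ∑ i, ⟪e i, w⟫ * b (e i) w := by
        simp only [map_sum, map_smul, LinearMap.sum_apply, LinearMap.smul_apply, smul_eq_mul]
      _ ≤ ∑ _i : Fin n, ‖w‖ * ε := by
        refine Finset.sum_le_sum fun i _ => (le_abs_self _).trans ?_
        rw [abs_mul]
        have h := abs_real_inner_le_norm (e i) w
        rw [e.norm_eq_one, one_mul] at h
        exact mul_le_mul h (hbw i) (abs_nonneg _) (norm_nonneg _)
      _ = n * ε * ‖w‖ := by
        simp only [Finset.sum_const, Finset.card_univ, Fintype.card_fin, nsmul_eq_mul]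
        ring
  rcases (norm_nonneg w).eq_or_lt with h0 | h0
  · rw [← h0]
    positivity
  · exact le_of_mul_le_mul_right (by linarith [hb w, sq ‖w‖]) h0

/-- Quantitative symplectic Gram–Schmidt: in the taming setup, if `ε ≤ ε₀(n,C)` then
`ω` admits a symplectic-type basis `e₁, e′₁, …, e_n, e′_n` in which the second family
of vectors differs from the `J`-rotation of the first by `O(ε)`. -/
theorem symplectic_gram_schmidt (n : ℕ) (hn : 1 ≤ n) (C : ℝ) (hC : 1 ≤ C) :
    ∃ ε₀ : ℝ, 0 < ε₀ ∧ ∃ K : ℝ, 0 < K ∧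
      ∀ (V : Type) [NormedAddCommGroup V] [InnerProductSpace ℝ V]
        [FiniteDimensional ℝ V], Module.finrank ℝ V = 2 * n →
        ∀ J : V →L[ℝ] V, (∀ v, J (J v) = -v) →
          (∀ u v : V, ⟪J u, J v⟫ = ⟪u, v⟫) →
          ∀ ω : V →ₗ[ℝ] V →ₗ[ℝ] ℝ, (∀ u v, ω u v = - ω v u) →
            (∀ v, ‖v‖ ^ 2 ≤ ω v (J v)) →
            (∀ u v, |ω u v| ≤ C * ‖u‖ * ‖v‖) →
            ∀ ε : ℝ, 0 ≤ ε → ε ≤ ε₀ →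
              (∀ u v, |ω u v - ω (J u) (J v)| ≤ 2 * ε * ‖u‖ * ‖v‖) →
              ∃ e e' : Fin n → V,
                LinearIndependent ℝ (Sum.elim e e') ∧
                Submodule.span ℝ (Set.range (Sum.elim e e')) = ⊤ ∧
                (∀ i, ‖e i‖ = 1) ∧
                (∀ i j, ω (e i) (e j) = 0) ∧
                (∀ i j, ω (e' i) (e' j) = 0) ∧
                (∀ i j, i ≠ j → ω (e i) (e' j) = 0) ∧
                (∀ i, 1 ≤ ω (e i) (e' i)) ∧
                (∀ i, ‖e' i - J (e i)‖ ≤ K * ε) := by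
  refine ⟨1, one_pos, n + n * (1 + n) ^ 2, ?_, ?_⟩
  · have : (1 : ℝ) ≤ n := by exact_mod_cast hn
    positivity
  intro V _ _ _ hV J hJ hJi ω hω htame _ ε hε hε1 hinv
  have hJn : ∀ v, ‖J v‖ = ‖v‖ := fun v => by
    rw [norm_eq_sqrt_real_inner, hJi, ← norm_eq_sqrt_real_inner]
  obtain ⟨L, hL, hiso⟩ := exists_isotropic_of_finrank_eq_two_mul hV ω hω le_rfl
  let b : L →ₗ[ℝ] L →ₗ[ℝ] ℝ := ω.compl₁₂ L.subtype (J.toLinearMap ∘ₗ L.subtype)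
  have hb : ∀ u v : L, b u v = ω u (J v) := fun u v => rfl
  have hbasym : ∀ u v : L, |b u v - b v u| ≤ 2 * ε * ‖u‖ * ‖v‖ := fun u v => by
    have h := hinv u (J v)
    rwa [hJ, map_neg, sub_neg_eq_add, ← sub_neg_eq_add, ← hω, hJn] at h
  obtain ⟨e, he⟩ := exists_orthonormalBasis_diagonalizing hL (b + b.flip) fun u v => by
    simp [add_comm]
  have hoff : ∀ i j, i ≠ j → |b (e i) (e j)| ≤ ε := fun i j hij => by
    have h1 := he i j hij
    have h2 := hbasym (e i) (e j)
    simp only [LinearMap.add_apply, LinearMap.flip_apply] at h1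
    rw [e.norm_eq_one, e.norm_eq_one, abs_le] at h2
    rw [abs_le]
    constructor <;> linarith
  obtain ⟨v, hvd, hvo, hvn⟩ := exists_dual_basis_near e b (fun v => htame v) hε hoff
  have hd : ∀ i, 1 ≤ b (e i) (e i) := fun i => by
    have h := htame (e i)
    rwa [Submodule.norm_coe, e.norm_eq_one, one_pow] at h
  have hvnorm : ∀ j, ‖v j‖ ≤ 1 + n := fun j => by
    have h1 := norm_le_norm_add_norm_sub' (v j) (e j)
    rw [e.norm_eq_one] at h1
    nlinarith [hvn j, Nat.cast_nonneg (α := ℝ) n]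
  let a : Fin n → Fin n → ℝ := fun i j => ω (J (v i)) (J (v j))
  have ha : ∀ i j, |a i j| ≤ 2 * ε * (1 + n) ^ 2 := fun i j => by
    have h := hinv (v i) (v j)
    rw [hiso _ (v i).2 _ (v j).2, zero_sub, abs_neg] at h
    refine h.trans ?_
    rw [sq, ← mul_assoc]
    gcongr
    exacts [hvnorm i, hvnorm j]
  let y : Fin n → Fin n → ℝ := fun j k => -(a j k) / (2 * b (e k) (e k))
  have hy : ∀ j k, |y j k| ≤ ε * (1 + n) ^ 2 := fun j k => by
    have hk := hd k
    simp only [y]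
    rw [abs_div, abs_neg, abs_of_pos (by linarith : 0 < 2 * b (e k) (e k)),
      div_le_iff₀ (by linarith)]
    have : 0 ≤ ε * (1 + n) ^ 2 := by positivity
    nlinarith [ha j k]
  have hyd : ∀ j k, y j k * b (e k) (e k) = -(a j k) / 2 := fun j k => by
    have := hd k
    simp only [y]
    field_simp
  let z : Fin n → L := fun j => ∑ k, y j k • e k
  have hz : ∀ j, ‖z j‖ ≤ n * (ε * (1 + n) ^ 2) := fun j => by
    refine (norm_sum_le _ _).trans ((Finset.sum_le_card_nsmul _ _ (ε * (1 + n) ^ 2) ?_).trans ?_)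
    · intro k _
      rw [norm_smul, e.norm_eq_one, mul_one]
      exact hy j k
    · simp
  have hzb : ∀ i j, b (z i) (v j) = -(a i j) / 2 := fun i j => by
    simp only [z, map_sum, map_smul, LinearMap.sum_apply, LinearMap.smul_apply, smul_eq_mul]
    rw [Finset.sum_eq_single j (fun k _ hkj => by rw [hvo k j hkj, mul_zero])
      (fun h => absurd (Finset.mem_univ j) h), hvd, hyd]
  have hee : ∀ i j, ω (e i) (e j) = 0 := fun i j => hiso _ (e i).2 _ (e j).2
  have hee' : ∀ i j, ω (e i) (J (v j) + z j) = b (e i) (v j) := fun i j => by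
    rw [map_add, hiso _ (e i).2 _ (z j).2, add_zero, hb]
  have hee'' : ∀ i j, ω (J (v i) + z i) (J (v j) + z j) = 0 := fun i j => by
    have h1 : ω (z i) (J (v j)) = -(a i j) / 2 := hzb i j
    have h2 : ω (J (v i)) (z j) = a j i / 2 := by
      rw [hω, ← hb, hzb]
      ring
    have h3 : ω (J (v i)) (J (v j)) = a i j := rfl
    have h4 : a j i = -a i j := hω _ _
    simp only [map_add, LinearMap.add_apply]
    rw [h1, h2, h3, h4, hiso _ (z i).2 _ (z j).2]
    ring
  have hdiag : ∀ i, 1 ≤ ω (e i) (J (v i) + z i) := fun i => by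
    rw [hee', hvd]
    exact hd i
  have hzero : ∀ i j, i ≠ j → ω (e i) (J (v j) + z j) = 0 := fun i j hij => by
    rw [hee', hvo i j hij]
  have hli := linearIndependent_sumElim_of_symplectic ω (fun i => (e i : V))
    (fun i => J (v i) + z i) hee hee'' hzero fun i => (one_pos.trans_le (hdiag i)).ne'
  refine ⟨fun i => e i, fun i => J (v i) + z i, hli, ?_, fun i => ?_, hee, hee'', hzero, hdiag,
    fun i => ?_⟩
  · refine hli.span_eq_top_of_card_eq_finrank' ?_
    rw [hV, Fintype.card_sum, Fintype.card_fin, two_mul]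
  · rw [Submodule.norm_coe, e.norm_eq_one]
  · have h1 : J (v i) + z i - J (e i) = J ((v i - e i : L) : V) + z i := by
      rw [Submodule.coe_sub, map_sub]
      abel
    rw [h1]
    refine (norm_add_le _ _).trans ?_
    rw [hJn, Submodule.norm_coe, Submodule.norm_coe]
    linarith [hvn i, hz i]
end

section
/- Let B be the open unit ball of ℝᴺ, let ε > 0, and let ω be a smooth closed 2-form on B (in the sense defined below) such that ‖ω(x)‖ ≤ ε for all x ∈ B and ‖Dʳω(x)‖ ≤ ε for all x ∈ B and all r ≥ 1. Then there exists a smooth map α from B to the continuous linear forms on ℝᴺ (a 1-form) such that: α(0) = 0; Dα(x)(u)(v) − Dα(x)(v)(u) = ω(x)(u, v) for all x ∈ B and u, v ∈ ℝᴺ (i.e. dα = ω); ‖α(x)‖ ≤ ε‖x‖ for all x ∈ B; and there exist constants C_r, depending only on N and r, such that ‖Dα(x)‖ ≤ C₁ε and ‖Dʳα(x)‖ ≤ C_r ε for all r ≥ 2 and all x ∈ B. (Quantitative Poincaré lemma on the ball.) -/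
open Metric

open Set Filter Topology

section RadialMoment

variable {E F : Type*} [NormedAddCommGroup E] [NormedSpace ℝ E]
  [NormedAddCommGroup F] [NormedSpace ℝ F]

/-- The average of `f` along the ray from `0` to `x`, with weight `t ^ m`. -/
noncomputable def radialMoment (m : ℕ) (f : E → F) (x : E) : F :=
  ∫ t in (0 : ℝ)..1, t ^ m • f (t • x)

theorem smul_mem_ball_zero {ρ t : ℝ} {x : E} (hx : x ∈ ball (0 : E) ρ) (ht : t ∈ Icc (0 : ℝ) 1) :
    t • x ∈ ball (0 : E) ρ := by
  rw [mem_ball_zero_iff] at hx ⊢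
  rw [norm_smul, Real.norm_of_nonneg ht.1]
  exact (mul_le_of_le_one_left (norm_nonneg x) ht.2).trans_lt hx

theorem ContinuousOn.pow_smul_comp_smul {f : E → F} (hf : ContinuousOn f (ball 0 1)) {x : E}
    (hx : x ∈ ball (0 : E) 1) (m : ℕ) :
    ContinuousOn (fun t : ℝ => t ^ m • f (t • x)) (Icc 0 1) :=
  (continuousOn_pow m).smul
    (hf.comp (by fun_prop) fun _ ht => smul_mem_ball_zero hx ht)

theorem ContinuousOn.intervalIntegrable_pow_smul_comp_smul {f : E → F}
    (hf : ContinuousOn f (ball 0 1)) {x : E} (hx : x ∈ ball (0 : E) 1) (m : ℕ) :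
    IntervalIntegrable (fun t : ℝ => t ^ m • f (t • x)) MeasureTheory.volume 0 1 :=
  (hf.pow_smul_comp_smul hx m).intervalIntegrable_of_Icc zero_le_one

theorem norm_radialMoment_le {f : E → F} {C : ℝ} (hC : ∀ x ∈ ball (0 : E) 1, ‖f x‖ ≤ C)
    (m : ℕ) {x : E} (hx : x ∈ ball (0 : E) 1) : ‖radialMoment m f x‖ ≤ C := by
  refine (intervalIntegral.norm_integral_le_of_norm_le_const fun t ht => ?_).trans_eq
    (show C * |(1 : ℝ) - 0| = C by simp)
  rw [uIoc_of_le zero_le_one] at ht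
  rw [norm_smul, norm_pow, Real.norm_of_nonneg ht.1.le]
  exact (mul_le_of_le_one_left (norm_nonneg _) (pow_le_one₀ ht.1.le ht.2)).trans
    (hC _ (smul_mem_ball_zero hx (Ioc_subset_Icc_self ht)))

theorem ContinuousLinearMap.map_radialMoment_eq_zero [CompleteSpace F] {G : Type*}
    [NormedAddCommGroup G] [NormedSpace ℝ G] [CompleteSpace G] (L : F →L[ℝ] G) {f : E → F}
    (hf : ContinuousOn f (ball 0 1)) (hL : ∀ x ∈ ball (0 : E) 1, L (f x) = 0) (m : ℕ) {x : E}
    (hx : x ∈ ball (0 : E) 1) : L (radialMoment m f x) = 0 := by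
  rw [radialMoment,
    ← L.intervalIntegral_comp_comm (hf.intervalIntegrable_pow_smul_comp_smul hx m)]
  refine intervalIntegral.integral_zero_ae (Eventually.of_forall fun t ht => ?_)
  rw [uIoc_of_le zero_le_one] at ht
  rw [map_smul, hL _ (smul_mem_ball_zero hx (Ioc_subset_Icc_self ht)), smul_zero]

theorem hasFDerivAt_radialMoment [ProperSpace E] {f : E → F} (hf : ContDiffOn ℝ 1 f (ball 0 1))
    (m : ℕ) {x : E} (hx : x ∈ ball (0 : E) 1) :
    HasFDerivAt (radialMoment m f) (radialMoment (m + 1) (fderivWithin ℝ f (ball 0 1)) x) x := by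
  have hf' : ContinuousOn (fderivWithin ℝ f (ball 0 1)) (ball 0 1) :=
    hf.continuousOn_fderivWithin isOpen_ball.uniqueDiffOn le_rfl
  obtain ⟨ρ, hxρ, hρ⟩ := exists_between (mem_ball_zero_iff.1 hx)
  have hsub : ball (0 : E) ρ ⊆ ball 0 1 := ball_subset_ball hρ.le
  obtain ⟨C, hC⟩ := (isCompact_closedBall (0 : E) ρ).exists_bound_of_continuousOn
    (hf'.mono (closedBall_subset_ball hρ))
  have hxρ' : ball (0 : E) ρ ∈ 𝓝 x := isOpen_ball.mem_nhds (mem_ball_zero_iff.2 hxρ)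
  refine intervalIntegral.hasFDerivAt_integral_of_dominated_of_fderiv_le
    (F := fun y t => t ^ m • f (t • y))
    (F' := fun y t => t ^ (m + 1) • fderivWithin ℝ f (ball 0 1) (t • y)) (bound := fun _ => C)
    hxρ' ?_ (hf.continuousOn.intervalIntegrable_pow_smul_comp_smul hx m) ?_ ?_
    intervalIntegrable_const ?_
  · filter_upwards [hxρ'] with y hy
    rw [uIoc_of_le zero_le_one]
    exact (hf.continuousOn.intervalIntegrable_pow_smul_comp_smul (hsub hy) m).aestronglyMeasurable
  · rw [uIoc_of_le zero_le_one]
    exact (hf'.intervalIntegrable_pow_smul_comp_smul hx (m + 1)).aestronglyMeasurable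
  · refine Eventually.of_forall fun t ht y hy => ?_
    rw [uIoc_of_le zero_le_one] at ht
    rw [norm_smul, norm_pow, Real.norm_of_nonneg ht.1.le]
    exact (mul_le_of_le_one_left (norm_nonneg _) (pow_le_one₀ ht.1.le ht.2)).trans
      (hC _ (ball_subset_closedBall (smul_mem_ball_zero hy (Ioc_subset_Icc_self ht))))
  · refine Eventually.of_forall fun t ht y hy => ?_
    rw [uIoc_of_le zero_le_one] at ht
    have hty := smul_mem_ball_zero (hsub hy) (Ioc_subset_Icc_self ht)
    have hd := ((hf.differentiableOn one_ne_zero).hasFDerivAt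
      (isOpen_ball.mem_nhds hty)).comp y ((hasFDerivAt_id y).const_smul t)
    rw [← fderivWithin_of_isOpen isOpen_ball hty] at hd
    refine (hd.const_smul (t ^ m)).congr_fderiv ?_
    ext v
    simp [pow_succ, mul_smul]

theorem eqOn_fderivWithin_radialMoment [ProperSpace E] {f : E → F}
    (hf : ContDiffOn ℝ 1 f (ball 0 1)) (m : ℕ) :
    EqOn (fderivWithin ℝ (radialMoment m f) (ball 0 1))
      (radialMoment (m + 1) (fderivWithin ℝ f (ball 0 1))) (ball 0 1) := fun x hx => by
  rw [fderivWithin_of_isOpen isOpen_ball hx, (hasFDerivAt_radialMoment hf m hx).fderiv]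

end RadialMoment

section Smooth

open scoped ContDiff

universe u

variable {E F : Type u} [NormedAddCommGroup E] [NormedSpace ℝ E]
  [NormedAddCommGroup F] [NormedSpace ℝ F]

theorem ContDiffOn.radialMoment [ProperSpace E] {f : E → F} (hf : ContDiffOn ℝ ∞ f (ball 0 1)) (m : ℕ) :
    ContDiffOn ℝ ∞ (radialMoment m f) (ball 0 1) := by
  refine contDiffOn_infty.2 fun n => ?_
  induction n generalizing F m with
  | zero =>
    exact contDiffOn_zero.2 fun x hx =>
      (hasFDerivAt_radialMoment (hf.of_le (by simp)) m hx).continuousAt.continuousWithinAt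
  | succ n ih =>
    have h1 : ContDiffOn ℝ 1 f (ball 0 1) := hf.of_le (by simp)
    push_cast
    refine (contDiffOn_succ_iff_fderivWithin isOpen_ball.uniqueDiffOn).2
      ⟨fun x hx => (hasFDerivAt_radialMoment h1 m hx).differentiableAt.differentiableWithinAt,
        by simp, ?_⟩
    exact (ih ((contDiffOn_infty_iff_fderivWithin isOpen_ball.uniqueDiffOn).1 hf).2 (m + 1)).congr
      (eqOn_fderivWithin_radialMoment h1 m)

theorem norm_iteratedFDerivWithin_radialMoment_le [ProperSpace E] {f : E → F}
    (hf : ContDiffOn ℝ ∞ f (ball 0 1)) {C : ℝ} (r : ℕ) (hC : ∀ x ∈ ball (0 : E) 1, ‖iteratedFDerivWithin ℝ r f (ball 0 1) x‖ ≤ C)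
    (m : ℕ) {x : E} (hx : x ∈ ball (0 : E) 1) :
    ‖iteratedFDerivWithin ℝ r (radialMoment m f) (ball 0 1) x‖ ≤ C := by
  induction r generalizing F m with
  | zero =>
    simp only [norm_iteratedFDerivWithin_zero] at hC ⊢
    exact norm_radialMoment_le hC m hx
  | succ r ih =>
    rw [← norm_iteratedFDerivWithin_fderivWithin isOpen_ball.uniqueDiffOn hx,
      iteratedFDerivWithin_congr (eqOn_fderivWithin_radialMoment (hf.of_le (by simp)) m) hx]
    refine ih ((contDiffOn_infty_iff_fderivWithin isOpen_ball.uniqueDiffOn).1 hf).2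
      (fun y hy => ?_) (m + 1)
    rw [norm_iteratedFDerivWithin_fderivWithin isOpen_ball.uniqueDiffOn hy]
    exact hC y hy

theorem norm_iteratedFDerivWithin_id_le {x : E} (hx : x ∈ ball (0 : E) 1) (r : ℕ) :
    ‖iteratedFDerivWithin ℝ r (fun y : E => y) (ball 0 1) x‖ ≤ 1 := by
  have hfd : EqOn (fderivWithin ℝ (fun y : E => y) (ball 0 1))
      (fun _ => ContinuousLinearMap.id ℝ E) (ball 0 1) :=
    fun y hy => fderivWithin_fun_id (isOpen_ball.uniqueDiffOn y hy)
  match r with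
  | 0 => simpa using (mem_ball_zero_iff.1 hx).le
  | 1 =>
    rw [← norm_iteratedFDerivWithin_fderivWithin isOpen_ball.uniqueDiffOn hx,
      norm_iteratedFDerivWithin_zero, hfd hx]
    exact ContinuousLinearMap.norm_id_le
  | r + 2 =>
    rw [← norm_iteratedFDerivWithin_fderivWithin isOpen_ball.uniqueDiffOn hx,
      iteratedFDerivWithin_congr hfd hx, iteratedFDerivWithin_succ_const]
    simp

theorem norm_iteratedFDerivWithin_apply_self_le {f : E → E →L[ℝ] F} {C : ℝ}
    (hf : ContDiffOn ℝ ∞ f (ball 0 1)) {x : E} (hx : x ∈ ball (0 : E) 1)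
    (hC : ∀ r : ℕ, ‖iteratedFDerivWithin ℝ r f (ball 0 1) x‖ ≤ C) (r : ℕ) :
    ‖iteratedFDerivWithin ℝ r (fun y => f y y) (ball 0 1) x‖ ≤ 2 ^ r * C := by
  refine (norm_iteratedFDerivWithin_clm_apply hf contDiffOn_id isOpen_ball.uniqueDiffOn hx
    (n := r) (by exact_mod_cast le_top)).trans ?_
  have hC0 : 0 ≤ C := (norm_nonneg _).trans (hC 0)
  calc _ ≤ ∑ i ∈ Finset.range (r + 1), (r.choose i : ℝ) * C := by
        refine Finset.sum_le_sum fun i _ => ?_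
        refine (mul_le_of_le_one_right (by positivity)
          (norm_iteratedFDerivWithin_id_le hx _)).trans ?_
        gcongr
        exact hC i
    _ = 2 ^ r * C := by
        rw [← Finset.sum_mul]
        exact_mod_cast congrArg (fun n : ℕ => (n : ℝ) * C) (Nat.sum_range_choose r)

end Smooth

section ClosedForm

variable {E F : Type*} [NormedAddCommGroup E] [NormedSpace ℝ E]
  [NormedAddCommGroup F] [NormedSpace ℝ F]

/-- Fundamental theorem of calculus for `t ↦ t ^ (m + 1) • f (t • x)` on `[0, 1]`. -/
theorem radialMoment_fderivWithin_apply_self [CompleteSpace F] {f : E → F}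
    (hf : ContDiffOn ℝ 1 f (ball 0 1)) (m : ℕ) {x : E} (hx : x ∈ ball (0 : E) 1) :
    radialMoment (m + 1) (fderivWithin ℝ f (ball 0 1)) x x
      + (m + 1 : ℝ) • radialMoment m f x = f x := by
  have hf' : ContinuousOn (fderivWithin ℝ f (ball 0 1)) (ball 0 1) :=
    hf.continuousOn_fderivWithin isOpen_ball.uniqueDiffOn le_rfl
  have hi' := hf'.intervalIntegrable_pow_smul_comp_smul hx (m + 1)
  have hi := hf.continuousOn.intervalIntegrable_pow_smul_comp_smul hx m
  have hi'x : IntervalIntegrable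
      (fun t : ℝ => (t ^ (m + 1) • fderivWithin ℝ f (ball 0 1) (t • x)) x)
      MeasureTheory.volume 0 1 :=
    ((hf'.pow_smul_comp_smul hx (m + 1)).clm_apply continuousOn_const).intervalIntegrable_of_Icc
      zero_le_one
  have hi2 : IntervalIntegrable (fun t : ℝ => (m + 1 : ℝ) • t ^ m • f (t • x))
      MeasureTheory.volume 0 1 := hi.smul _
  rw [radialMoment, ContinuousLinearMap.intervalIntegral_apply hi', radialMoment,
    ← intervalIntegral.integral_smul, ← intervalIntegral.integral_add hi'x hi2,
    intervalIntegral.integral_eq_sub_of_hasDerivAt (f := fun t : ℝ => t ^ (m + 1) • f (t • x))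
      (fun t ht => ?_) (hi'x.add hi2)]
  · simp
  · rw [uIcc_of_le zero_le_one] at ht
    have htx := smul_mem_ball_zero hx ht
    have hd := ((hf.differentiableOn one_ne_zero).hasFDerivAt
      (isOpen_ball.mem_nhds htx)).comp_hasDerivAt t ((hasDerivAt_id t).smul_const x)
    rw [← fderivWithin_of_isOpen isOpen_ball htx] at hd
    refine ((hasDerivAt_pow (m + 1) t).smul hd).congr_deriv ?_
    simp [mul_smul]

theorem fderivWithin_apply_apply_neg {ω : E → E →L[ℝ] E →L[ℝ] F} {s : Set E} (hs : IsOpen s)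
    (hω : DifferentiableOn ℝ ω s) (halt : ∀ x ∈ s, ∀ u v, ω x u v = -ω x v u)
    {x : E} (hx : x ∈ s) (u v w : E) :
    fderivWithin ℝ ω s x u v w = -fderivWithin ℝ ω s x u w v := by
  have hd := hω.hasFDerivAt (hs.mem_nhds hx)
  rw [← fderivWithin_of_isOpen hs hx] at hd
  have hvw := (hd.clm_apply (hasFDerivAt_const v x)).clm_apply (hasFDerivAt_const w x)
  have hwv := ((hd.clm_apply (hasFDerivAt_const w x)).clm_apply (hasFDerivAt_const v x)).neg
  have := hvw.unique (hwv.congr_of_eventuallyEq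
    (eventually_of_mem (hs.mem_nhds hx) fun y hy => halt y hy v w))
  simpa using DFunLike.congr_fun this u

end ClosedForm

/-- Quantitative Poincaré lemma on the unit ball of `ℝᴺ`: a smooth closed 2-form `ω`
with `‖ω‖ ≤ ε` and all derivatives bounded by `ε` has a smooth primitive `α`
(`dα = ω`) with `α(0) = 0`, `‖α(x)‖ ≤ ε‖x‖`, and `‖Dʳα‖ ≤ C_r ε` for `r ≥ 1`,
the constants `C_r` depending only on `N` and `r`. -/
theorem quantitative_poincare_lemma (N : ℕ) (hN : 1 ≤ N) :
    ∃ Cc : ℕ → ℝ, (∀ r, 0 < Cc r) ∧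
      ∀ ε : ℝ, 0 < ε →
        ∀ ω : EuclideanSpace ℝ (Fin N) →
            (EuclideanSpace ℝ (Fin N) →L[ℝ] EuclideanSpace ℝ (Fin N) →L[ℝ] ℝ),
          ContDiffOn ℝ (⊤ : ℕ∞) ω (ball 0 1) →
          (∀ x ∈ ball (0 : EuclideanSpace ℝ (Fin N)) 1, ∀ u v, ω x u v = - ω x v u) →
          (∀ x ∈ ball (0 : EuclideanSpace ℝ (Fin N)) 1, ∀ u v w,
            fderivWithin ℝ ω (ball 0 1) x u v w + fderivWithin ℝ ω (ball 0 1) x v w u +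
              fderivWithin ℝ ω (ball 0 1) x w u v = 0) →
          (∀ x ∈ ball (0 : EuclideanSpace ℝ (Fin N)) 1, ‖ω x‖ ≤ ε) →
          (∀ r : ℕ, 1 ≤ r → ∀ x ∈ ball (0 : EuclideanSpace ℝ (Fin N)) 1,
            ‖iteratedFDerivWithin ℝ r ω (ball 0 1) x‖ ≤ ε) →
          ∃ α : EuclideanSpace ℝ (Fin N) → (EuclideanSpace ℝ (Fin N) →L[ℝ] ℝ),
            ContDiffOn ℝ (⊤ : ℕ∞) α (ball 0 1) ∧
            α 0 = 0 ∧
            (∀ x ∈ ball (0 : EuclideanSpace ℝ (Fin N)) 1, ∀ u v,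
              fderivWithin ℝ α (ball 0 1) x u v - fderivWithin ℝ α (ball 0 1) x v u
                = ω x u v) ∧
            (∀ x ∈ ball (0 : EuclideanSpace ℝ (Fin N)) 1, ‖α x‖ ≤ ε * ‖x‖) ∧
            (∀ r : ℕ, 1 ≤ r → ∀ x ∈ ball (0 : EuclideanSpace ℝ (Fin N)) 1,
              ‖iteratedFDerivWithin ℝ r α (ball 0 1) x‖ ≤ Cc r * ε) := by
  refine ⟨fun r => 2 ^ r, fun r => by positivity, fun ε _ ω hω halt hclosed h0 hr => ?_⟩
  have h1 : ContDiffOn ℝ 1 ω (ball 0 1) := hω.of_le (by simp)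
  have hω' := ((contDiffOn_infty_iff_fderivWithin isOpen_ball.uniqueDiffOn).1 hω).2
  have hbound : ∀ r : ℕ, ∀ x ∈ ball (0 : EuclideanSpace ℝ (Fin N)) 1,
      ‖iteratedFDerivWithin ℝ r ω (ball 0 1) x‖ ≤ ε := fun r x hx => by
    rcases Nat.eq_zero_or_pos r with rfl | hr0
    · simpa using h0 x hx
    · exact hr r hr0 x hx
  have hH := hω.radialMoment 1
  refine ⟨fun x => radialMoment 1 ω x x, hH.clm_apply contDiffOn_id, by simp, fun x hx u v => ?_,
    fun x hx => ?_, fun r _ x hx => ?_⟩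
  · have hd : HasFDerivAt (fun y => radialMoment 1 ω y y) _ x :=
      (hasFDerivAt_radialMoment h1 1 hx).clm_apply (hasFDerivAt_id x)
    rw [fderivWithin_of_isOpen isOpen_ball hx, HasFDerivAt.fderiv hd]
    have hftc := radialMoment_fderivWithin_apply_self h1 1 hx
    let ev (a b : EuclideanSpace ℝ (Fin N)) :=
      ContinuousLinearMap.apply ℝ ℝ b ∘L
        ContinuousLinearMap.apply ℝ (EuclideanSpace ℝ (Fin N) →L[ℝ] ℝ) a
    let ev' (a b c : EuclideanSpace ℝ (Fin N)) :=
      ev b c ∘L ContinuousLinearMap.apply ℝ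
        (EuclideanSpace ℝ (Fin N) →L[ℝ] EuclideanSpace ℝ (Fin N) →L[ℝ] ℝ) a
    have hHalt := (ev u v + ev v u).map_radialMoment_eq_zero hω.continuousOn
      (fun y hy => by simp [ev, halt y hy u v]) 1 hx
    have hKalt := (ev' u x v + ev' u v x).map_radialMoment_eq_zero hω'.continuousOn
      (fun y hy => by
        simp [ev, ev', fderivWithin_apply_apply_neg isOpen_ball (h1.differentiableOn one_ne_zero)
          halt hy u x v]) 2 hx
    have hKclosed := (ev' x u v + ev' u v x + ev' v x u).map_radialMoment_eq_zero
      hω'.continuousOn (fun y hy => by simpa [ev, ev'] using hclosed y hy x u v) 2 hx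
    have hftcuv := congrArg (ev u v) hftc
    simp [ev, ev'] at hHalt hKalt hKclosed hftcuv ⊢
    linarith
  · exact (ContinuousLinearMap.le_opNorm _ _).trans
      (mul_le_mul_of_nonneg_right (norm_radialMoment_le h0 1 hx) (norm_nonneg x))
  · exact norm_iteratedFDerivWithin_apply_self_le hH hx
      (fun i => norm_iteratedFDerivWithin_radialMoment_le hω i (hbound i) 1 hx) r
end

section
/- Let ω₀ denote the standard linear symplectic form on ℝ²ⁿ (identified with ℂⁿ), namely ω₀(u, v) = Σⱼ (Re uⱼ · Im vⱼ − Im uⱼ · Re vⱼ). There exist constants ε₀ > 0, r ∈ (0, 1], and C_k > 0 (k ≥ 1), all depending only on n, with the following property. For every ε ≤ ε₀ and every smooth closed 2-form ω on the open unit ball B of ℝ²ⁿ (in the sense defined below) satisfying ω(0) = ω₀, ‖ω(x) − ω₀‖ ≤ ε for all x ∈ B, and ‖Dᵏω(x)‖ ≤ ε for all x ∈ B and all k ≥ 1, there exists a smooth embedding ρ of the ball B(0, r) into B such that: ρ(0) = 0; ω(ρ(x))(Dρ(x)u, Dρ(x)v) = ω₀(u, v) for all x ∈ B(0, r) and all u,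 v ∈ ℝ²ⁿ (i.e. ρ pulls ω back to the standard symplectic form, giving Darboux coordinates); ‖Dρ(x) − Id‖ ≤ C₁ε for all x ∈ B(0, r); and ‖Dᵏρ(x)‖ ≤ C_k ε for all k ≥ 2 and x ∈ B(0, r). (Quantitative Moser–Darboux theorem on the ball.) -/
open Metric

section
set_option maxSynthPendingDepth 3
open Set
open scoped NNReal ENNReal Topology ContDiff
universe u

theorem ContDiffOn.hasSum_taylor_of_bound {E F : Type*} [NormedAddCommGroup E] [NormedSpace ℝ E]
    [NormedAddCommGroup F] [NormedSpace ℝ F] [CompleteSpace F] {f : E → F} {r M : ℝ}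
    (hf : ContDiffOn ℝ (⊤ : ℕ∞) f (ball 0 r))
    (hM : ∀ k : ℕ, ∀ x ∈ ball (0 : E) r, ‖iteratedFDerivWithin ℝ k f (ball 0 r) x‖ ≤ M)
    {x : E} (hx : x ∈ ball (0 : E) r) :
    HasSum (fun k : ℕ => ((k.factorial : ℝ)⁻¹) •
      iteratedFDerivWithin ℝ k f (ball 0 r) 0 (fun _ => x)) (f x) := by
  set L : ℝ →L[ℝ] E := (ContinuousLinearMap.id ℝ ℝ).smulRight x with hL
  have hLt : ∀ t, L t = t • x := fun t => by simp [hL]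
  have hmem : ∀ t ∈ Icc (0 : ℝ) 1, L t ∈ ball (0 : E) r := by
    intro t ht
    rw [mem_ball_zero_iff] at hx ⊢
    rw [hLt, norm_smul, Real.norm_of_nonneg ht.1]
    exact (mul_le_of_le_one_left (norm_nonneg _) ht.2).trans_lt hx
  have hopen : IsOpen (L ⁻¹' ball 0 r) := isOpen_ball.preimage L.continuous
  have hg : ContDiffOn ℝ (⊤ : ℕ∞) (f ∘ L) (L ⁻¹' ball 0 r) :=
    hf.comp L.contDiff.contDiffOn (mapsTo_preimage _ _)
  have hder : ∀ k : ℕ, ∀ t ∈ Icc (0 : ℝ) 1, iteratedDerivWithin k (f ∘ L) (Icc 0 1) t =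
      iteratedFDerivWithin ℝ k f (ball 0 r) (L t) (fun _ => x) := by
    intro k t ht
    have h1 : iteratedFDerivWithin ℝ k (f ∘ L) (Icc 0 1) t =
        iteratedFDerivWithin ℝ k (f ∘ L) (L ⁻¹' ball 0 r) t := by
      rw [iteratedFDerivWithin_eq_iteratedFDeriv (uniqueDiffOn_Icc zero_lt_one)
        ((hg.contDiffAt (hopen.mem_nhds (hmem t ht))).of_le (by exact_mod_cast le_top)) ht,
        iteratedFDerivWithin_of_isOpen k hopen (hmem t ht)]
    rw [iteratedDerivWithin, h1, L.iteratedFDerivWithin_comp_right hf isOpen_ball.uniqueDiffOn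
      hopen.uniqueDiffOn (hmem t ht) (by exact_mod_cast le_top)]
    simp [hLt]
  have hbound : ∀ n : ℕ, ‖f x - ∑ k ∈ Finset.range (n + 1), ((k.factorial : ℝ)⁻¹) •
      iteratedFDerivWithin ℝ k f (ball 0 r) 0 (fun _ => x)‖ ≤
        M * (‖x‖ ^ (n + 1) / n.factorial) := by
    intro n
    have h := taylor_mean_remainder_bound (f := f ∘ L) (a := 0) (b := 1) (x := 1) (n := n)
      (C := M * ‖x‖ ^ (n + 1)) zero_le_one
      ((hg.mono fun t ht => hmem t ht).of_le (by exact_mod_cast le_top)) (by simp) (by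
        intro t ht
        rw [hder _ t ht]
        refine (ContinuousMultilinearMap.le_opNorm _ _).trans ?_
        simp only [Finset.prod_const, Finset.card_univ, Fintype.card_fin]
        gcongr
        exact hM _ _ (hmem t ht))
    rw [taylor_within_apply] at h
    simp only [sub_zero, one_pow, mul_one, Function.comp_apply, hLt, one_smul] at h
    have h0 : ∀ k : ℕ, iteratedDerivWithin k (f ∘ L) (Icc 0 1) 0 =
      iteratedFDerivWithin ℝ k f (ball 0 r) 0 (fun _ => x) := fun k => by
        rw [hder k 0 (by simp), hLt, zero_smul]
    simp only [h0] at h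
    rwa [mul_div_assoc] at h
  have hsum : Summable (fun k : ℕ => ((k.factorial : ℝ)⁻¹) •
      iteratedFDerivWithin ℝ k f (ball 0 r) 0 (fun _ => x)) := by
    refine Summable.of_norm_bounded (g := fun k : ℕ => M * (‖x‖ ^ k / k.factorial))
      ((Real.summable_pow_div_factorial ‖x‖).mul_left M) fun k => ?_
    rw [norm_smul, norm_inv, RCLike.norm_natCast, inv_mul_le_iff₀ (by positivity)]
    refine (ContinuousMultilinearMap.le_opNorm _ _).trans ?_
    simp only [Finset.prod_const, Finset.card_univ, Fintype.card_fin]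
    have hr : 0 < r := (norm_nonneg x).trans_lt (mem_ball_zero_iff.1 hx)
    calc _ ≤ M * ‖x‖ ^ k := by gcongr; exact hM k 0 (mem_ball_self hr)
      _ = _ := by field_simp
  rw [hsum.hasSum_iff_tendsto_nat, ← Filter.tendsto_add_atTop_iff_nat 1,
    tendsto_iff_norm_sub_tendsto_zero]
  have hlim : Filter.Tendsto (fun n : ℕ => M * (‖x‖ ^ (n + 1) / n.factorial)) Filter.atTop
      (nhds 0) := by
    have := ((FloorSemiring.tendsto_pow_div_factorial_atTop ‖x‖).const_mul (M * ‖x‖))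
    rw [mul_zero] at this
    refine this.congr fun n => ?_
    rw [pow_succ]; ring
  refine squeeze_zero (fun _ => norm_nonneg _) (fun n => ?_) hlim
  rw [norm_sub_rev]
  exact hbound n

theorem abs_inv_natCast_add_two_le_one (k : ℕ) : |((k : ℝ) + 2)⁻¹| ≤ 1 := by
  rw [abs_of_pos (by positivity)]
  exact inv_le_one_of_one_le₀ (by linarith [k.cast_nonneg (α := ℝ)])

section
variable {E F : Type*} [NormedAddCommGroup E] [NormedSpace ℝ E]
    [NormedAddCommGroup F] [NormedSpace ℝ F]

variable (E F) in
/-- The space of bounded sequences of Taylor coefficients of maps from `E` to `F`. -/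
def TaylorData : Type _ := lp (fun k : ℕ => E [×k]→L[ℝ] F) ∞

namespace TaylorData

noncomputable instance : NormedAddCommGroup (TaylorData E F) :=
  inferInstanceAs (NormedAddCommGroup (lp (fun k : ℕ => E [×k]→L[ℝ] F) ∞))

noncomputable instance : NormedSpace ℝ (TaylorData E F) :=
  inferInstanceAs (NormedSpace ℝ (lp (fun k : ℕ => E [×k]→L[ℝ] F) ∞))

instance [CompleteSpace F] : CompleteSpace (TaylorData E F) :=
  inferInstanceAs (CompleteSpace (lp (fun k : ℕ => E [×k]→L[ℝ] F) ∞))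

variable (E F) in
/-- The `k`-th coefficient, as a continuous linear map. -/
noncomputable def coeffL (k : ℕ) : TaylorData E F →L[ℝ] E [×k]→L[ℝ] F :=
  LinearMap.mkContinuous
    { toFun := fun q => q.1 k
      map_add' := fun _ _ => rfl
      map_smul' := fun _ _ => rfl } 1
    (fun q => by
      rw [one_mul]
      exact lp.norm_apply_le_norm (E := fun k : ℕ => E [×k]→L[ℝ] F) ENNReal.top_ne_zero q k)

theorem exists_coeffL_eq {a : ∀ k : ℕ, E [×k]→L[ℝ] F} {M : ℝ} (hM : 0 ≤ M)
    (ha : ∀ k, ‖a k‖ ≤ M) : ∃ q : TaylorData E F, ‖q‖ ≤ M ∧ ∀ k, coeffL E F k q = a k :=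
  ⟨⟨a, memℓp_infty ⟨M, by rintro _ ⟨k, rfl⟩; exact ha k⟩⟩, lp.norm_le_of_forall_le hM ha,
    fun _ => rfl⟩

theorem norm_coeffL_le (k : ℕ) : ‖coeffL E F k‖ ≤ 1 :=
  LinearMap.mkContinuous_norm_le _ zero_le_one _

variable (E F) in
/-- The power series whose sum at `x` sends `q` to `∑ c k / k! • q k (x, …, x)`. -/
noncomputable def evalSeries (c : ℕ → ℝ) :
    FormalMultilinearSeries ℝ E (TaylorData E F →L[ℝ] F) :=
  fun k => (c k / k.factorial) • (coeffL E F k).flipMultilinear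

variable (E F) in
/-- The map sending `x` to the functional `q ↦ ∑ c k / k! • q k (x, …, x)`. -/
noncomputable def weightedEval (c : ℕ → ℝ) (x : E) : TaylorData E F →L[ℝ] F :=
  (evalSeries E F c).sum x

variable {c : ℕ → ℝ}

theorem evalSeries_radius (hc : ∀ k, |c k| ≤ 1) : (evalSeries E F c).radius = ⊤ := by
  refine FormalMultilinearSeries.radius_eq_top_of_summable_norm _ fun r => ?_
  refine Summable.of_nonneg_of_le (fun _ => by positivity) (fun k => ?_)
    (Real.summable_pow_div_factorial r)
  have h1 : ‖(coeffL E F k).flipMultilinear‖ ≤ 1 :=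
    (MultilinearMap.mkContinuous_norm_le _ (norm_nonneg _) _).trans (norm_coeffL_le k)
  rw [evalSeries, norm_smul, norm_div, RCLike.norm_natCast, Real.norm_eq_abs]
  calc |c k| / k.factorial * ‖(coeffL E F k).flipMultilinear‖ * (r : ℝ) ^ k
      ≤ 1 / k.factorial * 1 * (r : ℝ) ^ k := by gcongr; exact hc k
    _ = _ := by ring

variable [CompleteSpace F]

theorem hasFPowerSeriesOnBall_weightedEval (hc : ∀ k, |c k| ≤ 1) :
    HasFPowerSeriesOnBall (weightedEval E F c) (evalSeries E F c) 0 ⊤ := by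
  have := (evalSeries E F c).hasFPowerSeriesOnBall (by rw [evalSeries_radius hc]; simp)
  rwa [evalSeries_radius hc] at this

theorem analyticAt_weightedEval (hc : ∀ k, |c k| ≤ 1) (x : E) :
    AnalyticAt ℝ (weightedEval E F c) x :=
  (hasFPowerSeriesOnBall_weightedEval hc).analyticAt_of_mem (by simp)

theorem hasSum_weightedEval (hc : ∀ k, |c k| ≤ 1) (x : E) (q : TaylorData E F) :
    HasSum (fun k : ℕ => (c k / k.factorial) • coeffL E F k q (fun _ => x))
      (weightedEval E F c x q) := by
  have h := (hasFPowerSeriesOnBall_weightedEval (E := E) (F := F) hc).hasSum (y := x) (by simp)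
  rw [zero_add] at h
  exact h.mapL (ContinuousLinearMap.apply ℝ F q)

theorem intervalIntegral_weightedEval (x : E) (q : TaylorData E F) :
    ∫ s in (0 : ℝ)..1, s • weightedEval E F (fun _ => 1) (s • x) q =
      weightedEval E F (fun k => ((k : ℝ) + 2)⁻¹) x q := by
  set a : ℕ → F := fun k => ((1 : ℝ) / k.factorial) • coeffL E F k q (fun _ => x) with ha
  have h := intervalIntegral.hasSum_integral_of_dominated_convergence (μ := MeasureTheory.volume)
    (a := (0 : ℝ)) (b := 1) (F := fun (k : ℕ) (s : ℝ) => (s ^ (k + 1)) • a k)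
    (f := fun s => s • weightedEval E F (fun _ => 1) (s • x) q)
    (fun k _ => ‖q‖ * (‖x‖ ^ k / k.factorial))
    (fun k => (by fun_prop : Continuous _).aestronglyMeasurable) ?_ ?_ ?_ ?_
  · have h2 : ∀ k : ℕ, ∫ s in (0 : ℝ)..1, (s ^ (k + 1)) • a k =
        ((((k : ℝ) + 2)⁻¹) / k.factorial) • coeffL E F k q (fun _ => x) := fun k => by
      rw [intervalIntegral.integral_smul_const, integral_pow, ha, smul_smul]
      congr 1
      push_cast
      field_simp
      ring
    simp only [h2] at h
    exact h.unique (hasSum_weightedEval abs_inv_natCast_add_two_le_one x q)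
  · refine fun k => .of_forall fun s hs => ?_
    rw [uIoc_of_le zero_le_one] at hs
    rw [ha, norm_smul, norm_smul, norm_pow, norm_div, RCLike.norm_natCast, norm_one]
    have h1 : ‖coeffL E F k q (fun _ => x)‖ ≤ ‖q‖ * ‖x‖ ^ k := by
      refine (ContinuousMultilinearMap.le_opNorm _ _).trans ?_
      simp only [Finset.prod_const, Finset.card_univ, Fintype.card_fin]
      gcongr
      exact (ContinuousLinearMap.le_of_opNorm_le _ (norm_coeffL_le k) q).trans_eq (one_mul _)
    have h2 : ‖s‖ ^ (k + 1) ≤ 1 := pow_le_one₀ (norm_nonneg _) (by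
      rw [Real.norm_of_nonneg hs.1.le]; exact hs.2)
    calc _ ≤ 1 * (1 / k.factorial * (‖q‖ * ‖x‖ ^ k)) := by gcongr
      _ = _ := by ring
  · exact .of_forall fun s _ => (Real.summable_pow_div_factorial ‖x‖).mul_left ‖q‖
  · exact intervalIntegrable_const
  · refine .of_forall fun s _ => ?_
    have := (hasSum_weightedEval (c := fun _ => 1) (by simp) (s • x) q).const_smul s
    convert this using 2 with k
    rw [ha, (coeffL E F k q).map_smul_univ (fun _ => s) (fun _ => x)]
    simp only [Finset.prod_const, Finset.card_univ, Fintype.card_fin, smul_smul]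
    congr 1
    ring

end TaylorData
end

section
variable {E : Type*} [NormedAddCommGroup E] [NormedSpace ℝ E]

theorem hasFDerivAt_intervalIntegral_smul_comp_smul [FiniteDimensional ℝ E] {F : Type*}
    [NormedAddCommGroup F] [NormedSpace ℝ F] {η : E → F} (hη : ContDiff ℝ 1 η) (x : E) :
    HasFDerivAt (fun y => ∫ s in (0 : ℝ)..1, s • η (s • y))
      (∫ s in (0 : ℝ)..1, (s ^ 2) • fderiv ℝ η (s • x)) x := by
  have hc : Continuous η := hη.continuous
  have hc' : Continuous (fderiv ℝ η) := hη.continuous_fderiv one_ne_zero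
  have : ProperSpace E := FiniteDimensional.proper ℝ E
  obtain ⟨C, hC⟩ := (isCompact_closedBall (0 : E) (‖x‖ + 1)).exists_bound_of_continuousOn
    hc'.continuousOn
  refine intervalIntegral.hasFDerivAt_integral_of_dominated_of_fderiv_le
    (F' := fun y s => (s ^ 2) • fderiv ℝ η (s • y)) (bound := fun _ => C)
    (ball_mem_nhds x one_pos) (.of_forall fun y => ?_) ?_ ?_ (.of_forall fun s hs y hy => ?_)
    intervalIntegrable_const (.of_forall fun s _ y _ => ?_)
  · exact (by fun_prop : Continuous fun s : ℝ => s • η (s • y)).aestronglyMeasurable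
  · exact (by fun_prop : Continuous fun s : ℝ => s • η (s • x)).intervalIntegrable _ _
  · exact (by fun_prop : Continuous fun s : ℝ => (s ^ 2) • fderiv ℝ η (s • x)).aestronglyMeasurable
  · rw [uIoc_of_le zero_le_one] at hs
    have hs1 : ‖s‖ ≤ 1 := by rw [Real.norm_of_nonneg hs.1.le]; exact hs.2
    have hy' : ‖y‖ ≤ ‖x‖ + 1 := by
      have := norm_sub_norm_le y x
      rw [mem_ball_iff_norm] at hy
      linarith
    rw [norm_smul, norm_pow]
    have h1 := hC (s • y) (by
      rw [mem_closedBall_zero_iff, norm_smul]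
      exact (mul_le_of_le_one_left (norm_nonneg _) hs1).trans hy')
    calc _ ≤ 1 * C := by gcongr; exact pow_le_one₀ (norm_nonneg _) hs1
      _ = C := one_mul C
  · have h1 : HasFDerivAt (fun z : E => s • z) (s • ContinuousLinearMap.id ℝ E) y :=
      (hasFDerivAt_id y).const_smul s
    have h2 := (((hη.differentiable one_ne_zero) (s • y)).hasFDerivAt.comp y h1).const_smul s
    refine h2.congr_fderiv ?_
    ext v
    simp [pow_two, mul_smul]

theorem HasFDerivAt.apply_antisymm {η : E → E →L[ℝ] E →L[ℝ] ℝ}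
    {η' : E →L[ℝ] E →L[ℝ] E →L[ℝ] ℝ} {y : E} (h : HasFDerivAt η η' y)
    (halt : ∀ᶠ z in 𝓝 y, ∀ u v, η z u v = -η z v u) (w u v : E) : η' w u v = -η' w v u := by
  have h1 := (h.clm_apply (hasFDerivAt_const u y)).clm_apply (hasFDerivAt_const v y)
  have h2 := ((h.clm_apply (hasFDerivAt_const v y)).clm_apply (hasFDerivAt_const u y)).neg
  have h3 := h1.unique (h2.congr_of_eventuallyEq (halt.mono fun z hz => hz u v))
  simpa using congrArg (fun T : E →L[ℝ] ℝ => T w) h3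

theorem HasFDerivAt.hasDerivAt_apply₂ {η : E → E →L[ℝ] E →L[ℝ] ℝ}
    {η' : E →L[ℝ] E →L[ℝ] E →L[ℝ] ℝ} {g : ℝ → E} {g' : E} {t : ℝ} (h : HasFDerivAt η η' (g t))
    (hg : HasDerivAt g g' t) (u v : E) : HasDerivAt (fun s => η (g s) u v) (η' g' u v) t := by
  simpa using ((h.comp_hasDerivAt t hg).clm_apply
    (hasDerivAt_const t u)).clm_apply (hasDerivAt_const t v)

/-- The Poincaré lemma for 2-forms: `y ↦ ∫ s in 0..1, s • η (s • y) y` is a primitive of `η`. -/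
theorem exteriorDerivative_primitive [FiniteDimensional ℝ E]
    {η : E → E →L[ℝ] E →L[ℝ] ℝ} (hη : ContDiff ℝ 1 η)
    (halt : ∀ y ∈ ball (0 : E) 1, ∀ u v, η y u v = -η y v u)
    (hcl : ∀ y ∈ ball (0 : E) 1, ∀ u v w,
      fderiv ℝ η y u v w + fderiv ℝ η y v w u + fderiv ℝ η y w u v = 0)
    {x : E} (hx : x ∈ ball (0 : E) 1) (u v : E) :
    (∫ s in (0 : ℝ)..1, (s ^ 2) • fderiv ℝ η (s • x)) u x v
        + (∫ s in (0 : ℝ)..1, s • η (s • x)) u v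
      - ((∫ s in (0 : ℝ)..1, (s ^ 2) • fderiv ℝ η (s • x)) v x u
        + (∫ s in (0 : ℝ)..1, s • η (s • x)) v u) = η x u v := by
  have hc : Continuous η := hη.continuous
  have hc' : Continuous (fderiv ℝ η) := hη.continuous_fderiv one_ne_zero
  have hd : Differentiable ℝ η := hη.differentiable one_ne_zero
  have halt' : ∀ y ∈ ball (0 : E) 1, ∀ w u v, fderiv ℝ η y w u v = -fderiv ℝ η y w v u :=
    fun y hy => (hd y).hasFDerivAt.apply_antisymm
      ((isOpen_ball.eventually_mem hy).mono halt)
  have e1 : ∀ a b c, (∫ s in (0 : ℝ)..1, (s ^ 2) • fderiv ℝ η (s • x)) a b c =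
      ∫ s in (0 : ℝ)..1, s ^ 2 * fderiv ℝ η (s • x) a b c := fun a b c => by
    rw [ContinuousLinearMap.intervalIntegral_apply, ContinuousLinearMap.intervalIntegral_apply,
      ContinuousLinearMap.intervalIntegral_apply]
    · rfl
    all_goals exact (by fun_prop : Continuous _).intervalIntegrable _ _
  have e2 : ∀ a b, (∫ s in (0 : ℝ)..1, s • η (s • x)) a b =
      ∫ s in (0 : ℝ)..1, s * η (s • x) a b := fun a b => by
    rw [ContinuousLinearMap.intervalIntegral_apply, ContinuousLinearMap.intervalIntegral_apply]
    · rfl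
    all_goals exact (by fun_prop : Continuous _).intervalIntegrable _ _
  have i1 : ∀ a b c, IntervalIntegrable (fun s : ℝ => s ^ 2 * fderiv ℝ η (s • x) a b c)
      MeasureTheory.volume 0 1 := fun a b c => (by fun_prop : Continuous _).intervalIntegrable _ _
  have i2 : ∀ a b, IntervalIntegrable (fun s : ℝ => s * η (s • x) a b)
      MeasureTheory.volume 0 1 := fun a b => (by fun_prop : Continuous _).intervalIntegrable _ _
  rw [e1, e1, e2, e2, ← intervalIntegral.integral_add (i1 _ _ _) (i2 _ _),
    ← intervalIntegral.integral_add (i1 _ _ _) (i2 _ _),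
    ← intervalIntegral.integral_sub ((i1 _ _ _).add (i2 _ _)) ((i1 _ _ _).add (i2 _ _))]
  have hderiv : ∀ s ∈ uIcc (0 : ℝ) 1, HasDerivAt (fun s : ℝ => s ^ 2 * η (s • x) u v)
      (2 * s * η (s • x) u v + s ^ 2 * fderiv ℝ η (s • x) x u v) s := by
    intro s _
    have h1 : HasDerivAt (fun s : ℝ => s • x) x s := by
      simpa using (hasDerivAt_id s).smul_const x
    have h2 := (hd (s • x)).hasFDerivAt.hasDerivAt_apply₂ h1 u v
    refine ((hasDerivAt_pow 2 s).mul h2).congr_deriv ?_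
    simp
  have := intervalIntegral.integral_eq_sub_of_hasDerivAt hderiv
    ((by fun_prop : Continuous _).intervalIntegrable _ _)
  simp only [one_pow, one_smul, one_mul, ne_eq, OfNat.ofNat_ne_zero, not_false_eq_true, zero_pow,
    zero_mul, sub_zero] at this
  rw [← this]
  refine intervalIntegral.integral_congr fun s hs => ?_
  rw [uIcc_of_le zero_le_one] at hs
  have hsx : s • x ∈ ball (0 : E) 1 := by
    rw [mem_ball_zero_iff] at hx ⊢
    rw [norm_smul, Real.norm_of_nonneg hs.1]
    exact (mul_le_of_le_one_left (norm_nonneg _) hs.2).trans_lt hx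
  linear_combination (-s ^ 2) * hcl _ hsx u v x + s ^ 2 * halt' _ hsx u x v
    - s * halt _ hsx v u

/-- The infinitesimal Moser identity: if `i_Y Ω = -α` with `Ω` closed and `dα = η`, then
`η + L_Y Ω = 0`. -/
theorem add_lieDerivative_eq_zero {Ω β : E → E →L[ℝ] E →L[ℝ] ℝ} {Y : E → E}
    {Ω' β' : E →L[ℝ] E →L[ℝ] E →L[ℝ] ℝ} {Y' : E →L[ℝ] E} {η : E →L[ℝ] E →L[ℝ] ℝ} {x : E}
    (hΩ : HasFDerivAt Ω Ω' x) (hβ : HasFDerivAt β β' x) (hY : HasFDerivAt Y Y' x)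
    (hYΩ : ∀ᶠ y in 𝓝 x, Ω y (Y y) = -β y y)
    (halt : ∀ u v, Ω x u v = -Ω x v u) (halt' : ∀ w u v, Ω' w u v = -Ω' w v u)
    (hcl : ∀ u v w, Ω' u v w + Ω' v w u + Ω' w u v = 0)
    (hη : ∀ u v, β' u x v + β x u v - (β' v x u + β x v u) = η u v) (u v : E) :
    η u v + Ω' (Y x) u v + Ω x (Y' u) v + Ω x u (Y' v) = 0 := by
  have h := (hΩ.clm_apply hY).unique
    (((hβ.clm_apply (hasFDerivAt_id x)).neg).congr_of_eventuallyEq hYΩ)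
  have h1 := congrArg (fun T : E →L[ℝ] E →L[ℝ] ℝ => T u v) h
  have h2 := congrArg (fun T : E →L[ℝ] E →L[ℝ] ℝ => T v u) h
  simp at h1 h2
  linear_combination -hη u v + h1 - h2 + halt u (Y' v) - halt' u v (Y x) + hcl u v (Y x)
end

section
variable {K G H : Type*} [TopologicalSpace K] [CompactSpace K] [NormedAddCommGroup G]
  [NormedSpace ℝ G] [NormedAddCommGroup H] [NormedSpace ℝ H]

variable (K) in
/-- Pointwise application of a continuous multilinear map to continuous functions. -/
noncomputable def ContinuousMultilinearMap.compLeftContinuousMap {k : ℕ} (p : G [×k]→L[ℝ] H) :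
    C(K, G) [×k]→L[ℝ] C(K, H) :=
  MultilinearMap.mkContinuous
    { toFun := fun γ => ⟨fun t => p fun i => γ i t, by fun_prop⟩
      map_update_add' := fun {_} γ i a b => by
        ext t
        have h : ∀ c : C(K, G), (fun j => Function.update γ i c j t) =
            Function.update (fun j => γ j t) i (c t) := fun c => by
          ext j; by_cases hj : j = i
          · subst hj; simp
          · simp [hj]
        simp only [ContinuousMap.coe_mk, ContinuousMap.add_apply, h, p.map_update_add]
      map_update_smul' := fun {_} γ i a b => by
        ext t
        have h : ∀ c : C(K, G), (fun j => Function.update γ i c j t) =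
            Function.update (fun j => γ j t) i (c t) := fun c => by
          ext j; by_cases hj : j = i
          · subst hj; simp
          · simp [hj]
        simp only [ContinuousMap.coe_mk, ContinuousMap.smul_apply, h, p.map_update_smul] }
    ‖p‖ (fun γ => by
      refine (ContinuousMap.norm_le _ (by positivity)).2 fun t => ?_
      refine (p.le_opNorm _).trans ?_
      gcongr with i
      exact (γ i).norm_coe_le_norm t)

theorem ContinuousMultilinearMap.norm_compLeftContinuousMap_le {k : ℕ} (p : G [×k]→L[ℝ] H) :
    ‖p.compLeftContinuousMap K‖ ≤ ‖p‖ := MultilinearMap.mkContinuous_norm_le _ (norm_nonneg _) _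

/-- The superposition operator of an analytic function is analytic on spaces of continuous
functions. -/
theorem AnalyticAt.exists_superposition (K : Type*) [TopologicalSpace K] [CompactSpace K]
    [CompleteSpace H] {f : G → H} (hf : AnalyticAt ℝ f 0) :
    ∃ N : C(K, G) → C(K, H), AnalyticAt ℝ N 0 ∧
      ∃ r > 0, ∀ γ ∈ ball (0 : C(K, G)) r, AnalyticAt ℝ N γ ∧
        ∀ t, AnalyticAt ℝ f (γ t) ∧ N γ t = f (γ t) ∧
          ∀ κ, fderiv ℝ N γ κ t = fderiv ℝ f (γ t) (κ t) := by
  obtain ⟨p, r, hp⟩ := hf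
  set P : FormalMultilinearSeries ℝ C(K, G) C(K, H) :=
    fun k => (p k).compLeftContinuousMap K with hP
  have hrad : p.radius ≤ P.radius := by
    refine ENNReal.le_of_forall_nnreal_lt fun s hs => ?_
    obtain ⟨C, -, hC⟩ := p.norm_mul_pow_le_of_lt_radius hs
    exact P.le_radius_of_bound C fun k => (by gcongr; exact (p k).norm_compLeftContinuousMap_le :
      ‖P k‖ * (s : ℝ) ^ k ≤ ‖p k‖ * (s : ℝ) ^ k).trans (hC k)
  have hsum : HasFPowerSeriesOnBall P.sum P 0 r :=
    (P.hasFPowerSeriesOnBall ((hp.r_pos.trans_le hp.r_le).trans_le hrad)).mono hp.r_pos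
      (hp.r_le.trans hrad)
  obtain ⟨s, hs0, hsr⟩ := ENNReal.lt_iff_exists_nnreal_btwn.1 hp.r_pos
  have hs : ((s : ℝ≥0) : ℝ) > 0 := by exact_mod_cast hs0
  have hγt : ∀ γ ∈ ball (0 : C(K, G)) s, ∀ t, γ t ∈ eball (0 : G) r := fun γ hγ t =>
    eball_subset_eball hsr.le (by
      rw [eball_coe, mem_ball_zero_iff]
      exact (γ.norm_coe_le_norm t).trans_lt (mem_ball_zero_iff.1 hγ))
  have hmem : ∀ γ ∈ ball (0 : C(K, G)) s, γ ∈ eball (0 : C(K, G)) r := fun γ hγ =>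
    eball_subset_eball hsr.le (by rwa [eball_coe])
  have hN : ∀ γ ∈ ball (0 : C(K, G)) s, ∀ t, P.sum γ t = f (γ t) := fun γ hγ t => by
    have h1 := (hsum.hasSum (hmem γ hγ)).mapL (ContinuousMap.evalCLM ℝ t)
    have h2 := hp.hasSum (hγt γ hγ t)
    rw [zero_add] at h1 h2
    exact h1.unique h2
  refine ⟨P.sum, hsum.analyticAt, s, hs, fun γ hγ =>
    ⟨hsum.analyticAt_of_mem (hmem γ hγ), fun t => ?_⟩⟩
  have hft := hp.analyticAt_of_mem (hγt γ hγ t)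
  refine ⟨hft, hN γ hγ t, fun κ => ?_⟩
  let eH : C(K, H) →L[ℝ] H := ContinuousMap.evalCLM ℝ t
  let eG : C(K, G) →L[ℝ] G := ContinuousMap.evalCLM ℝ t
  have h1 : HasFDerivAt (eH ∘ P.sum) (eH ∘L fderiv ℝ P.sum γ) γ :=
    eH.hasFDerivAt.comp γ (hsum.analyticAt_of_mem (hmem γ hγ)).differentiableAt.hasFDerivAt
  have h2 : HasFDerivAt (f ∘ eG) (fderiv ℝ f (γ t) ∘L eG) γ :=
    HasFDerivAt.comp γ hft.differentiableAt.hasFDerivAt eG.hasFDerivAt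
  have h3 := h1.unique (h2.congr_of_eventuallyEq
    ((isOpen_ball.eventually_mem hγ).mono fun γ' hγ' => hN γ' hγ' t))
  exact congrArg (fun T : C(K, G) →L[ℝ] H => T κ) h3
end

section
variable {E : Type*} [NormedAddCommGroup E] [NormedSpace ℝ E]

variable (E) in
/-- The Volterra operator `g ↦ ∫ s in 0..t, g s` on continuous functions on `[0, 1]`. -/
noncomputable def volterra : C(Icc (0 : ℝ) 1, E) →L[ℝ] C(Icc (0 : ℝ) 1, E) :=
  LinearMap.mkContinuous
    { toFun := fun g => ⟨fun t => ∫ s in (0 : ℝ)..t, g (projIcc 0 1 zero_le_one s),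
        (intervalIntegral.continuous_primitive (fun a b =>
          (g.continuous.comp continuous_projIcc).intervalIntegrable a b) 0).comp
          continuous_subtype_val⟩
      map_add' := fun g h => by
        ext t
        exact intervalIntegral.integral_add
          ((g.continuous.comp continuous_projIcc).intervalIntegrable _ _)
          ((h.continuous.comp continuous_projIcc).intervalIntegrable _ _)
      map_smul' := fun c g => by
        ext t
        exact intervalIntegral.integral_smul c _ } 1
    (fun g => by
      rw [one_mul]
      refine (ContinuousMap.norm_le _ (norm_nonneg _)).2 fun t => ?_
      refine (intervalIntegral.norm_integral_le_of_norm_le_const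
        (fun s _ => g.norm_coe_le_norm _)).trans ?_
      rw [sub_zero, abs_of_nonneg t.2.1]
      exact mul_le_of_le_one_right (norm_nonneg _) t.2.2)

theorem exists_hasDerivAt_of_eq_volterra [CompleteSpace E] {γ h : C(Icc (0 : ℝ) 1, E)} {y : E}
    {δ : ℝ} (hγ : ∀ t, γ t = y + δ • volterra E h t) :
    ∃ w : ℝ → E, w 0 = y ∧ (∀ t : Icc (0 : ℝ) 1, w t = γ t) ∧
      ∀ t : Icc (0 : ℝ) 1, HasDerivAt w (δ • h t) t := by
  have hc : Continuous fun s => h (projIcc 0 1 zero_le_one s) :=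
    h.continuous.comp continuous_projIcc
  refine ⟨fun t => y + δ • ∫ s in (0 : ℝ)..t, h (projIcc 0 1 zero_le_one s), by simp,
    fun t => (hγ t).symm, fun t => ?_⟩
  have h1 := intervalIntegral.integral_hasDerivAt_right (hc.intervalIntegrable 0 t)
    (hc.stronglyMeasurableAtFilter _ _) hc.continuousAt
  simpa using (h1.const_smul δ).const_add y

variable {P : Type*} [NormedAddCommGroup P] [NormedSpace ℝ P]

variable (E P) in
/-- The map sending `((y, δ, q), u)` to the path `t ↦ (δ * t, y + u t, q)`. -/
noncomputable def graphPath :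
    (E × ℝ × P) × C(Icc (0 : ℝ) 1, E) →L[ℝ] C(Icc (0 : ℝ) 1, ℝ × E × P) :=
  (ContinuousLinearMap.fst ℝ ℝ P ∘L ContinuousLinearMap.snd ℝ E (ℝ × P) ∘L
      ContinuousLinearMap.fst ℝ _ _).smulRight
      (⟨fun t => ((t : ℝ), 0, 0), by fun_prop⟩ : C(Icc (0 : ℝ) 1, ℝ × E × P)) +
    (ContinuousLinearMap.const ℝ (Icc (0 : ℝ) 1) ∘L ContinuousLinearMap.inr ℝ ℝ (E × P) ∘L
      ((ContinuousLinearMap.fst ℝ E (ℝ × P)).prod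
        (ContinuousLinearMap.snd ℝ ℝ P ∘L ContinuousLinearMap.snd ℝ E (ℝ × P))) ∘L
      ContinuousLinearMap.fst ℝ _ _) +
    ((ContinuousLinearMap.inr ℝ ℝ (E × P) ∘L ContinuousLinearMap.inl ℝ E P).compLeftContinuous
      ℝ (Icc (0 : ℝ) 1) ∘L ContinuousLinearMap.snd ℝ _ _)

theorem graphPath_apply (y : E) (δ : ℝ) (q : P) (u : C(Icc (0 : ℝ) 1, E)) (t : Icc (0 : ℝ) 1) :
    graphPath E P ((y, δ, q), u) t = (δ * t, y + u t, q) := by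
  simp [graphPath]

/-- The flow of a time-dependent analytic vector field `f (s, ·, q)` with parameter `q`, run over
the time interval `[0, δ]`, depends analytically on `(y, δ, q)`. -/
theorem AnalyticAt.exists_flow [CompleteSpace E] [CompleteSpace P] {f : ℝ × E × P → E}
    (hf : AnalyticAt ℝ f 0) (hf0 : ∀ s q, f (s, 0, q) = 0) :
    ∃ Ψ : E × ℝ × P → C(Icc (0 : ℝ) 1, E), AnalyticAt ℝ Ψ 0 ∧ Ψ 0 = 0 ∧
      ∀ᶠ a in 𝓝 (0 : E × ℝ × P), (a.1 = 0 → Ψ a = 0) ∧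
        ∃ w : ℝ → E, w 0 = a.1 ∧ (∀ t : Icc (0 : ℝ) 1, w t = Ψ a t) ∧
          (∀ t : Icc (0 : ℝ) 1, HasDerivAt w (a.2.1 • f (a.2.1 * t, w t, a.2.2)) t) ∧
          ∀ v : E, ∃ W : ℝ → E, W 0 = v ∧ W 1 = fderiv ℝ Ψ a (v, 0, 0) 1 ∧
            ∀ t : Icc (0 : ℝ) 1,
              HasDerivAt W (a.2.1 • fderiv ℝ f (a.2.1 * t, w t, a.2.2) (0, W t, 0)) t := by
  obtain ⟨N, hN, r, hr, hNr⟩ := hf.exists_superposition (Icc (0 : ℝ) 1)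
  have hN0 : N 0 = 0 := by
    ext t
    rw [((hNr 0 (mem_ball_self hr)).2 t).2.1]
    exact hf0 0 0
  set R : (E × ℝ × P) × C(Icc (0 : ℝ) 1, E) → C(Icc (0 : ℝ) 1, E) :=
    fun z => z.1.2.1 • volterra E (N (graphPath E P z)) with hR
  let πδ : E × ℝ × P →L[ℝ] ℝ :=
    ContinuousLinearMap.fst ℝ ℝ P ∘L ContinuousLinearMap.snd ℝ E (ℝ × P)
  let πδ' : (E × ℝ × P) × C(Icc (0 : ℝ) 1, E) →L[ℝ] ℝ := πδ ∘L ContinuousLinearMap.fst ℝ _ _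
  have hδ : ∀ z : (E × ℝ × P) × C(Icc (0 : ℝ) 1, E),
      AnalyticAt ℝ (fun z : (E × ℝ × P) × C(Icc (0 : ℝ) 1, E) => z.1.2.1) z :=
    πδ'.analyticAt
  have hRan : ∀ z, AnalyticAt ℝ N (graphPath E P z) → AnalyticAt ℝ R z := fun z hz =>
    (hδ z).smul (((volterra E).analyticAt _).comp (hz.comp ((graphPath E P).analyticAt z)))
  have hRan0 : AnalyticAt ℝ R 0 := hRan 0 (by simpa using hN)
  have hR0 : HasFDerivAt R (0 : (E × ℝ × P) × C(Icc (0 : ℝ) 1, E) →L[ℝ] C(Icc (0 : ℝ) 1, E)) 0 := by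
    have h2 : DifferentiableAt ℝ (fun z => volterra E (N (graphPath E P z)))
        (0 : (E × ℝ × P) × C(Icc (0 : ℝ) 1, E)) :=
      (((volterra E).analyticAt _).comp (AnalyticAt.comp (by simpa using hN)
        ((graphPath E P).analyticAt 0))).differentiableAt
    have h3 := (πδ'.hasFDerivAt (x := 0)).smul h2.hasFDerivAt
    refine h3.congr_fderiv ?_
    simp [hN0, πδ', πδ]
  set Φ : (E × ℝ × P) × C(Icc (0 : ℝ) 1, E) → (E × ℝ × P) × C(Icc (0 : ℝ) 1, E) :=
    fun z => (z.1, z.2 - R z) with hΦ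
  have hΦan : AnalyticAt ℝ Φ 0 := analyticAt_fst.prod (analyticAt_snd.sub hRan0)
  have hΦd : HasFDerivAt Φ ((ContinuousLinearEquiv.refl ℝ ((E × ℝ × P) × C(Icc (0 : ℝ) 1, E)) :
      ((E × ℝ × P) × C(Icc (0 : ℝ) 1, E)) →L[ℝ] _)) 0 := by
    refine (hasFDerivAt_fst.prodMk (hasFDerivAt_snd.sub hR0)).congr_fderiv ?_
    ext <;> simp
  have hR00 : R 0 = 0 := by simp [hR]
  have hΦ0 : Φ 0 = 0 := by simp [hΦ, hR00]
  have hcd : ContDiffAt ℝ ω Φ 0 := hΦan.contDiffAt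
  have hst : HasStrictFDerivAt Φ _ 0 := hcd.hasStrictFDerivAt' hΦd (by simp)
  set Θ := hcd.localInverse hΦd (by simp) with hΘ
  have hΘan : AnalyticAt ℝ Θ 0 := by
    have := hcd.to_localInverse hΦd (by simp)
    rw [hΦ0] at this
    exact this.analyticAt
  have hΘ0 : Θ 0 = 0 := by
    have := hcd.localInverse_apply_image hΦd (by simp)
    rwa [hΦ0] at this
  have hleft : ∀ᶠ z in 𝓝 0, Θ (Φ z) = z := hst.eventually_left_inverse
  have hright : ∀ᶠ z in 𝓝 0, Φ (Θ z) = z := by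
    have := hst.eventually_right_inverse
    rwa [hΦ0] at this
  have hin : Filter.Tendsto (fun a : E × ℝ × P => (a, (0 : C(Icc (0 : ℝ) 1, E)))) (𝓝 0) (𝓝 0) :=
    Continuous.tendsto' (by fun_prop) _ _ rfl
  set U : E × ℝ × P → C(Icc (0 : ℝ) 1, E) := fun a => (Θ (a, 0)).2 with hU
  have hUan : AnalyticAt ℝ U 0 := by
    have h1 : AnalyticAt ℝ (fun a : E × ℝ × P => (a, (0 : C(Icc (0 : ℝ) 1, E)))) 0 :=
      analyticAt_id.prod analyticAt_const
    exact (analyticAt_snd.comp (AnalyticAt.comp (f := fun a : E × ℝ × P =>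
      (a, (0 : C(Icc (0 : ℝ) 1, E)))) hΘan h1))
  have hU0 : U 0 = 0 := by
    have : Θ ((0 : E × ℝ × P), (0 : C(Icc (0 : ℝ) 1, E))) = 0 := hΘ0
    simp [hU, this]
  have hUeq : ∀ᶠ a in 𝓝 0, U a = R (a, U a) := by
    filter_upwards [hin.eventually hright] with a ha
    have h1 : (Θ (a, 0)).1 = a := congrArg Prod.fst ha
    have h2 : (Θ (a, 0)).2 - R (Θ (a, 0)) = 0 := congrArg Prod.snd ha
    have h3 : Θ (a, 0) = (a, U a) := Prod.ext h1 rfl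
    rw [h3] at h2
    exact sub_eq_zero.1 h2
  set Ψ : E × ℝ × P → C(Icc (0 : ℝ) 1, E) :=
    fun a => ContinuousLinearMap.const ℝ (Icc (0 : ℝ) 1) a.1 + U a with hΨ
  let cst : E × ℝ × P →L[ℝ] C(Icc (0 : ℝ) 1, E) :=
    ContinuousLinearMap.const ℝ (Icc (0 : ℝ) 1) ∘L ContinuousLinearMap.fst ℝ E (ℝ × P)
  refine ⟨Ψ, (cst.analyticAt 0).add hUan, by simp [hΨ, hU0], ?_⟩
  have hball1 : ∀ᶠ a in 𝓝 0, graphPath E P (a, U a) ∈ ball 0 r := by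
    have : ContinuousAt (fun a => graphPath E P (a, U a)) 0 :=
      (graphPath E P).continuous.continuousAt.comp (continuousAt_id.prodMk hUan.continuousAt)
    refine this (isOpen_ball.mem_nhds ?_)
    change graphPath E P (0, U 0) ∈ ball 0 r
    rw [hU0]
    exact (map_zero (graphPath E P)).symm ▸ mem_ball_self hr
  have hball0 : ∀ᶠ a in 𝓝 0, graphPath E P (a, 0) ∈ ball 0 r :=
    (((graphPath E P).continuous.tendsto' 0 0 (map_zero _)).comp hin) (ball_mem_nhds 0 hr)
  filter_upwards [hUeq, hUeq.eventually_nhds, hball1, hball0, hin.eventually hleft,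
    hUan.eventually_analyticAt] with a haU haU' hab hab0 hal haan
  obtain ⟨y, δ, q⟩ := a
  have hNa := hNr _ hab
  refine ⟨fun hy => ?_, ?_⟩
  · obtain rfl : y = 0 := hy
    have h1 : N (graphPath E P ((0, δ, q), 0)) = 0 := by
      ext t
      rw [((hNr _ hab0).2 t).2.1, graphPath_apply]
      simpa using hf0 (δ * t) q
    have h2 : Φ ((0, δ, q), 0) = ((0, δ, q), 0) := by simp [hΦ, hR, h1]
    rw [h2] at hal
    simp [hΨ, hU, hal]
  have h1 : ∀ t, Ψ (y, δ, q) t =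
      y + δ • volterra E (N (graphPath E P ((y, δ, q), U (y, δ, q)))) t :=
    fun t => by
      have := congrArg (fun g : C(Icc (0 : ℝ) 1, E) => y + g t) haU
      simpa [hΨ, hR] using this
  obtain ⟨w, hw0, hw, hwd⟩ := exists_hasDerivAt_of_eq_volterra h1
  have hwU : ∀ t : Icc (0 : ℝ) 1, w t = y + U (y, δ, q) t := fun t => by simp [hw, hΨ]
  refine ⟨w, hw0, hw, fun t => ?_, fun v => ?_⟩
  · have := hwd t
    rwa [(hNa.2 t).2.1, graphPath_apply, ← hwU] at this
  set V := fderiv ℝ U (y, δ, q) (v, 0, 0) with hV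
  set κ := fderiv ℝ N (graphPath E P ((y, δ, q), U (y, δ, q))) (graphPath E P ((v, 0, 0), V))
    with hκ
  have hVeq : V = δ • volterra E κ := by
    have h2 : HasFDerivAt (fun a => (a, U a)) ((ContinuousLinearMap.id ℝ _).prod _) (y, δ, q) :=
      (hasFDerivAt_id (𝕜 := ℝ) (y, δ, q)).prodMk haan.differentiableAt.hasFDerivAt
    have h3 := (volterra E).hasFDerivAt.comp (y, δ, q)
      (HasFDerivAt.comp (y, δ, q) hNa.1.differentiableAt.hasFDerivAt
        ((graphPath E P).hasFDerivAt.comp (y, δ, q) h2))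
    have h4 := (πδ.hasFDerivAt (x := (y, δ, q))).smul h3
    have h5 := haan.differentiableAt.hasFDerivAt.unique (h4.congr_of_eventuallyEq haU')
    have h6 := congrArg (fun T : E × ℝ × P →L[ℝ] C(Icc (0 : ℝ) 1, E) => T (v, 0, 0)) h5
    simpa [πδ] using h6
  have h2 : ∀ t, (ContinuousLinearMap.const ℝ (Icc (0 : ℝ) 1) v + V) t =
      v + δ • volterra E κ t := fun t => by
    have := congrArg (fun g : C(Icc (0 : ℝ) 1, E) => v + g t) hVeq
    simpa using this
  obtain ⟨W, hW0, hW, hWd⟩ := exists_hasDerivAt_of_eq_volterra h2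
  have hWV : ∀ t : Icc (0 : ℝ) 1, W t = v + V t := fun t => by simp [hW]
  have hΨd : fderiv ℝ Ψ (y, δ, q) (v, 0, 0) =
      ContinuousLinearMap.const ℝ (Icc (0 : ℝ) 1) v + V := by
    have h3 : HasFDerivAt Ψ (cst + fderiv ℝ U (y, δ, q)) (y, δ, q) :=
      cst.hasFDerivAt.add haan.differentiableAt.hasFDerivAt
    rw [h3.fderiv]
    rfl
  refine ⟨W, hW0, ?_, fun t => ?_⟩
  · rw [hΨd]
    exact hW 1
  · have := hWd t
    rwa [hκ, (hNa.2 t).2.2, graphPath_apply, graphPath_apply, ← hwU, mul_comm (0 : ℝ), mul_zero,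
      ← hWV] at this
end

section
variable {E F : Type u} {D P : Type*} [NormedAddCommGroup E] [NormedSpace ℝ E]
  [NormedAddCommGroup F] [NormedSpace ℝ F] [NormedAddCommGroup D] [NormedSpace ℝ D]
  [NormedAddCommGroup P] [NormedSpace ℝ P]

theorem HasFPowerSeriesOnBall.exists_norm_iteratedFDeriv_partial_le [CompleteSpace F]
    {g : E × D × P → F} {p : FormalMultilinearSeries ℝ (E × D × P) F} {R : ℝ≥0∞} {r : ℝ≥0}
    (hg : HasFPowerSeriesOnBall g p 0 R) (hr : r < R)
    (h0 : ∀ y d, (y, d, (0 : P)) ∈ eball 0 R → g (y, d, 0) = 0) (k : ℕ) :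
    ∃ C : ℝ, 0 < C ∧ ∀ y d q, (y, d, q) ∈ ball (0 : E × D × P) r →
      ‖iteratedFDeriv ℝ k (fun y => g (y, d, q)) y‖ ≤ C * ‖q‖ := by
  have hsub : ball (0 : E × D × P) r ⊆ eball 0 R := by
    rw [← eball_coe]; exact eball_subset_eball hr.le
  induction k generalizing F with
  | zero =>
    obtain ⟨a, ha, C, hC, h⟩ := hg.fderiv.uniform_geometric_approx hr
    have hb : ∀ z ∈ ball (0 : E × D × P) r, ‖fderiv ℝ g z‖ ≤ C := fun z hz => by
      simpa [FormalMultilinearSeries.partialSum] using h z hz 0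
    refine ⟨C, hC, fun y d q hz => ?_⟩
    have hz0 : (y, d, (0 : P)) ∈ ball (0 : E × D × P) r := by
      simp only [mem_ball_zero_iff, Prod.norm_def, sup_lt_iff] at hz ⊢
      exact ⟨hz.1, hz.2.1, by simpa using (norm_nonneg y).trans_lt hz.1⟩
    have := (convex_ball (0 : E × D × P) r).norm_image_sub_le_of_norm_fderiv_le (𝕜 := ℝ)
      (fun z hz => (hg.analyticAt_of_mem (hsub hz)).differentiableAt) hb hz0 hz
    simpa [h0 y d (hsub hz0)] using this
  | succ k ih =>
    let T : (E × D × P →L[ℝ] F) →L[ℝ] (E →L[ℝ] F) :=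
      (ContinuousLinearMap.compL ℝ E (E × D × P) F).flip (ContinuousLinearMap.inl ℝ E (D × P))
    have hgy : ∀ y d q, (y, d, q) ∈ eball (0 : E × D × P) R →
        HasFDerivAt (fun y => g (y, d, q)) (T (fderiv ℝ g (y, d, q))) y := fun y d q hz =>
      (hg.analyticAt_of_mem hz).differentiableAt.hasFDerivAt.comp y
        (hasFDerivAt_prodMk_left y (d, q))
    have hnear : ∀ y d q, (y, d, q) ∈ eball (0 : E × D × P) R →
        ∀ᶠ y' in 𝓝 y, (y', d, q) ∈ eball (0 : E × D × P) R := fun y d q hz =>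
      (Continuous.continuousAt (f := fun y' : E => (y', d, q)) (by fun_prop)).eventually
        (isOpen_eball.mem_nhds hz)
    obtain ⟨C, hC, h⟩ := ih (T.comp_hasFPowerSeriesOnBall hg.fderiv) (fun y d hz => by
      have h1 : HasFDerivAt (fun y => g (y, d, 0)) (0 : E →L[ℝ] F) y :=
        (hasFDerivAt_const (0 : F) y).congr_of_eventuallyEq
          ((hnear y d 0 hz).mono fun y' hy' => h0 y' d hy')
      exact (hgy y d 0 hz).unique h1)
    refine ⟨C, hC, fun y d q hz => ?_⟩
    rw [← norm_iteratedFDeriv_fderiv]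
    refine le_of_eq_of_le ?_ (h y d q hz)
    refine congrArg _ (Filter.EventuallyEq.eq_of_nhds (Filter.EventuallyEq.iteratedFDeriv ℝ ?_ k))
    exact (hnear y d q (hsub hz)).mono fun y' hy' => (hgy y' d q hy').fderiv

/-- Partial derivatives of all orders of an analytic function vanishing for `q = 0` are
`O(‖q‖)`, uniformly on a ball that does not depend on the order. -/
theorem AnalyticAt.exists_norm_iteratedFDeriv_partial_le [CompleteSpace F] {g : E × D × P → F}
    (hg : AnalyticAt ℝ g 0) (h0 : ∀ᶠ a in 𝓝 (0 : E × D × P), a.2.2 = 0 → g a = 0) :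
    ∃ r > 0, ∀ k, ∃ C : ℝ, 0 < C ∧ ∀ y d q, (y, d, q) ∈ ball (0 : E × D × P) r →
      ‖iteratedFDeriv ℝ k (fun y => g (y, d, q)) y‖ ≤ C * ‖q‖ := by
  obtain ⟨p, R, hp⟩ := hg
  obtain ⟨s, hs, hs0⟩ := EMetric.mem_nhds_iff.1 h0
  obtain ⟨r, hr, hrR⟩ := ENNReal.lt_iff_exists_nnreal_btwn.1 (lt_min hp.r_pos hs)
  refine ⟨r, by exact_mod_cast hr, fun k => ?_⟩
  exact (hp.mono (lt_min hp.r_pos hs) (min_le_left _ _)).exists_norm_iteratedFDeriv_partial_le hrR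
    (fun y d h => hs0 (eball_subset_eball (min_le_right _ _) h) rfl) k
end

section
variable {E : Type*} [NormedAddCommGroup E] [NormedSpace ℝ E]

open TaylorData in
/-- The time-dependent vector field of the Moser trick for the path of 2-forms
`s ↦ ω₀ + s • η`, where `η` is the 2-form with Taylor data `q`. -/
noncomputable def moserField (ω₀ : E →L[ℝ] E →L[ℝ] ℝ)
    (z : ℝ × E × TaylorData E (E →L[ℝ] E →L[ℝ] ℝ)) : E :=
  -(ω₀ + z.1 • weightedEval E (E →L[ℝ] E →L[ℝ] ℝ) (fun _ => 1) z.2.1 z.2.2).inverse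
    (weightedEval E (E →L[ℝ] E →L[ℝ] ℝ) (fun k => ((k : ℝ) + 2)⁻¹) z.2.1 z.2.2 z.2.1)

theorem moserField_zero_left (ω₀ : E →L[ℝ] E →L[ℝ] ℝ) (s : ℝ)
    (q : TaylorData E (E →L[ℝ] E →L[ℝ] ℝ)) : moserField ω₀ (s, 0, q) = 0 := by
  simp [moserField]

theorem moserField_zero_right (ω₀ : E →L[ℝ] E →L[ℝ] ℝ) (s : ℝ) (y : E) :
    moserField ω₀ (s, y, 0) = 0 := by
  simp [moserField]

theorem contDiffAt_add_smul_weightedEval (ω₀ : E →L[ℝ] E →L[ℝ] ℝ)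
    (z : ℝ × E × TaylorData E (E →L[ℝ] E →L[ℝ] ℝ)) :
    ContDiffAt ℝ ω (fun z : ℝ × E × TaylorData E (E →L[ℝ] E →L[ℝ] ℝ) => ω₀ + z.1 •
      TaylorData.weightedEval E (E →L[ℝ] E →L[ℝ] ℝ) (fun _ => 1) z.2.1 z.2.2) z := by
  have h1 : ContDiffAt ℝ ω (TaylorData.weightedEval E (E →L[ℝ] E →L[ℝ] ℝ) (fun _ => 1)) z.2.1 :=
    (TaylorData.analyticAt_weightedEval (fun _ => by simp) _).contDiffAt
  have h2 := h1.comp z (contDiffAt_fst.comp z contDiffAt_snd)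
  exact contDiffAt_const.add (contDiffAt_fst.smul
    (h2.clm_apply (contDiffAt_snd.comp z contDiffAt_snd)))

theorem analyticAt_moserField [CompleteSpace E] {ω₀ : E →L[ℝ] E →L[ℝ] ℝ}
    {z : ℝ × E × TaylorData E (E →L[ℝ] E →L[ℝ] ℝ)} (hz : (ω₀ + z.1 •
      TaylorData.weightedEval E (E →L[ℝ] E →L[ℝ] ℝ) (fun _ => 1) z.2.1 z.2.2).IsInvertible) :
    AnalyticAt ℝ (moserField ω₀) z := by
  have h1 := contDiffAt_add_smul_weightedEval ω₀ z
  have h2 : ContDiffAt ℝ ω (TaylorData.weightedEval E (E →L[ℝ] E →L[ℝ] ℝ)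
      (fun k => ((k : ℝ) + 2)⁻¹)) z.2.1 :=
    (TaylorData.analyticAt_weightedEval abs_inv_natCast_add_two_le_one _).contDiffAt
  have h3 := ((h2.comp z (contDiffAt_fst.comp z contDiffAt_snd)).clm_apply
    (contDiffAt_snd.comp z contDiffAt_snd)).clm_apply (contDiffAt_fst.comp z contDiffAt_snd)
  exact ((ContDiffAt.comp z hz.contDiffAt_map_inverse h1).clm_apply h3).neg.analyticAt

theorem eventually_apply_moserField [CompleteSpace E] {ω₀ : E →L[ℝ] E →L[ℝ] ℝ}
    (hω₀ : ω₀.IsInvertible) :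
    ∀ᶠ z in 𝓝 (0 : ℝ × E × TaylorData E (E →L[ℝ] E →L[ℝ] ℝ)),
      (ω₀ + z.1 • TaylorData.weightedEval E (E →L[ℝ] E →L[ℝ] ℝ) (fun _ => 1) z.2.1 z.2.2)
        (moserField ω₀ z) = -TaylorData.weightedEval E (E →L[ℝ] E →L[ℝ] ℝ)
          (fun k => ((k : ℝ) + 2)⁻¹) z.2.1 z.2.2 z.2.1 := by
  obtain ⟨e, rfl⟩ := hω₀
  have h1 := (contDiffAt_add_smul_weightedEval (e : E →L[ℝ] E →L[ℝ] ℝ) 0).continuousAt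
  have h2 := h1.eventually (p := fun T => T ∈ range ((↑) : (E ≃L[ℝ] E →L[ℝ] ℝ) → _))
    (by simp only [Prod.fst_zero, zero_smul, add_zero]; exact e.nhds)
  filter_upwards [h2] with z hz
  rw [moserField, map_neg, ContinuousLinearMap.IsInvertible.self_apply_inverse hz]

/-- The pullback of `ω₀ + s • η` by the flow of the Moser vector field is constant. -/
theorem hasDerivAt_moser_pullback [FiniteDimensional ℝ E] {ω₀ : E →L[ℝ] E →L[ℝ] ℝ}
    (hω₀ : ∀ u v, ω₀ u v = -ω₀ v u) {η : E → E →L[ℝ] E →L[ℝ] ℝ}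
    {q : TaylorData E (E →L[ℝ] E →L[ℝ] ℝ)}
    (hη : η = fun x => TaylorData.weightedEval E (E →L[ℝ] E →L[ℝ] ℝ) (fun _ => 1) x q)
    (halt : ∀ x ∈ ball (0 : E) 1, ∀ u v, η x u v = -η x v u)
    (hcl : ∀ x ∈ ball (0 : E) 1, ∀ u v w,
      fderiv ℝ η x u v w + fderiv ℝ η x v w u + fderiv ℝ η x w u v = 0)
    {w W₁ W₂ : ℝ → E} {δ t : ℝ} (hwt : w t ∈ ball (0 : E) 1)
    (han : AnalyticAt ℝ (moserField ω₀) (δ * t, w t, q))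
    (hspec : ∀ᶠ y in 𝓝 (w t), (ω₀ + (δ * t) • η y) (moserField ω₀ (δ * t, y, q)) =
      -TaylorData.weightedEval E (E →L[ℝ] E →L[ℝ] ℝ) (fun k => ((k : ℝ) + 2)⁻¹) y q y)
    (hw : HasDerivAt w (δ • moserField ω₀ (δ * t, w t, q)) t)
    (hW₁ : HasDerivAt W₁ (δ • fderiv ℝ (moserField ω₀) (δ * t, w t, q) (0, W₁ t, 0)) t)
    (hW₂ : HasDerivAt W₂ (δ • fderiv ℝ (moserField ω₀) (δ * t, w t, q) (0, W₂ t, 0)) t) :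
    HasDerivAt (fun t => (ω₀ + (δ * t) • η (w t)) (W₁ t) (W₂ t)) 0 t := by
  have hcd : ∀ c : ℕ → ℝ, (∀ k, |c k| ≤ 1) → ContDiff ℝ 1
      (fun x => TaylorData.weightedEval E (E →L[ℝ] E →L[ℝ] ℝ) c x q) := fun c hc =>
    contDiff_iff_contDiffAt.2 fun x =>
      (TaylorData.analyticAt_weightedEval hc x).contDiffAt.clm_apply contDiffAt_const
  have hηc : ContDiff ℝ 1 η := hη ▸ hcd _ fun _ => by simp
  have hηd : HasFDerivAt η (fderiv ℝ η (w t)) (w t) :=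
    (hηc.differentiable one_ne_zero _).hasFDerivAt
  have hβ := hasFDerivAt_intervalIntegral_smul_comp_smul hηc (w t)
  have hβeq : ∀ x, ∫ s in (0 : ℝ)..1, s • η (s • x) =
      TaylorData.weightedEval E (E →L[ℝ] E →L[ℝ] ℝ) (fun k => ((k : ℝ) + 2)⁻¹) x q := fun x => by
    rw [hη]; exact TaylorData.intervalIntegral_weightedEval x q
  have hin : HasFDerivAt (fun y => (δ * t, y, q))
      (ContinuousLinearMap.inr ℝ ℝ (E × TaylorData E (E →L[ℝ] E →L[ℝ] ℝ)) ∘L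
        ContinuousLinearMap.inl ℝ E (TaylorData E (E →L[ℝ] E →L[ℝ] ℝ))) (w t) :=
    HasFDerivAt.comp (g := fun z : E × TaylorData E (E →L[ℝ] E →L[ℝ] ℝ) => (δ * t, z)) (w t)
      (hasFDerivAt_prodMk_right (δ * t) (w t, q)) (hasFDerivAt_prodMk_left (w t) q)
  have hY : HasFDerivAt (fun y => moserField ω₀ (δ * t, y, q)) _ (w t) :=
    HasFDerivAt.comp (g := moserField ω₀) (w t) han.differentiableAt.hasFDerivAt hin
  have hball : ∀ᶠ z in 𝓝 (w t), z ∈ ball (0 : E) 1 := isOpen_ball.mem_nhds hwt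
  have hΩ : HasFDerivAt (fun y => ω₀ + (δ * t) • η y) ((δ * t) • fderiv ℝ η (w t)) (w t) :=
    (hηd.const_smul (δ * t)).const_add ω₀
  have key := add_lieDerivative_eq_zero hΩ hβ hY (hspec.mono fun y hy => by rw [hy, hβeq])
    (fun u v => by simp [hω₀ u v, halt _ hwt u v]; ring)
    (fun x u v => by
      have := hηd.apply_antisymm (hball.mono halt) x u v
      simp [this])
    (fun u v x => by
      have := hcl _ hwt u v x
      simp only [smul_apply, smul_eq_mul]
      linear_combination (δ * t) * this)
    (exteriorDerivative_primitive hηc halt hcl hwt) (W₁ t) (W₂ t)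
  have hδ : HasDerivAt (fun s => δ * s) δ t := by simpa using (hasDerivAt_id t).const_mul δ
  have h1 := (((hδ.smul (hηd.comp_hasDerivAt t hw)).const_add ω₀).clm_apply hW₁).clm_apply hW₂
  refine h1.congr_deriv ?_
  simp at key ⊢
  linear_combination δ * key

/-- The Moser trick for the 2-form `ω₀ + δ • η`, uniformly in the Taylor data `q` of `η`. -/
theorem exists_moser_diffeo {E : Type u} [NormedAddCommGroup E] [NormedSpace ℝ E]
    [FiniteDimensional ℝ E] {ω₀ : E →L[ℝ] E →L[ℝ] ℝ} (hω₀ : ω₀.IsInvertible)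
    (hω₀' : ∀ u v, ω₀ u v = -ω₀ v u) :
    ∃ δ : ℝ, 0 < δ ∧ ∃ r : ℝ, 0 < r ∧ ∃ C : ℕ → ℝ, (∀ k, 0 < C k) ∧
      ∀ (q : TaylorData E (E →L[ℝ] E →L[ℝ] ℝ)) (η : E → E →L[ℝ] E →L[ℝ] ℝ), ‖q‖ < r →
        (η = fun x => TaylorData.weightedEval E (E →L[ℝ] E →L[ℝ] ℝ) (fun _ => 1) x q) →
        (∀ x ∈ ball (0 : E) 1, ∀ u v, η x u v = -η x v u) →
        (∀ x ∈ ball (0 : E) 1, ∀ u v w,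
          fderiv ℝ η x u v w + fderiv ℝ η x v w u + fderiv ℝ η x w u v = 0) →
        ∃ ρ : E → E, ρ 0 = 0 ∧ ∀ x ∈ ball (0 : E) r, ContDiffAt ℝ ω ρ x ∧
          (∀ u v, (ω₀ + δ • η (ρ x)) (fderiv ℝ ρ x u) (fderiv ℝ ρ x v) = ω₀ u v) ∧
          ∀ k, ‖iteratedFDeriv ℝ k (fun y => ρ y - y) x‖ ≤ C k * ‖q‖ := by
  have : CompleteSpace E := FiniteDimensional.complete ℝ E
  have hf : AnalyticAt ℝ (moserField ω₀) 0 := analyticAt_moserField (by simpa using hω₀)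
  obtain ⟨Ψ, hΨ, hΨ0, hev⟩ := hf.exists_flow (moserField_zero_left ω₀)
  have hz : ∀ᶠ z in 𝓝 (0 : ℝ × E × TaylorData E (E →L[ℝ] E →L[ℝ] ℝ)), z ∈ ball 0 1 :=
    ball_mem_nhds 0 one_pos
  obtain ⟨s, hs, hsz⟩ := Metric.eventually_nhds_iff_ball.1 (hf.eventually_analyticAt.and
    ((eventually_apply_moserField hω₀).eventually_nhds.and hz))
  let ev1 : C(Icc (0 : ℝ) 1, E) →L[ℝ] E := ContinuousMap.evalCLM ℝ 1
  have hψ : AnalyticAt ℝ (fun a => ev1 (Ψ a)) 0 := (ev1.analyticAt _).comp hΨ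
  have hsmall : ∀ᶠ a in 𝓝 0, Ψ a ∈ ball 0 s := hΨ.continuousAt
    (isOpen_ball.mem_nhds (by simpa [hΨ0] using hs))
  obtain ⟨r₁, hr₁, hk⟩ := AnalyticAt.exists_norm_iteratedFDeriv_partial_le
    (hψ.sub analyticAt_fst) (hev.mono fun a ha h0 => by
      obtain ⟨-, w, hw0, hw, hwd, -⟩ := ha
      have := constant_of_has_deriv_right_zero (f := w) (a := 0) (b := 1)
        (fun t ht => (hwd ⟨t, ht⟩).continuousAt.continuousWithinAt)
        (fun t ht => by
          have := hwd ⟨t, Ico_subset_Icc_self ht⟩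
          rw [h0, moserField_zero_right, smul_zero] at this
          exact this.hasDerivWithinAt) 1 (right_mem_Icc.2 zero_le_one)
      rw [hw0] at this
      change Ψ a 1 - a.1 = 0
      rw [← hw 1, sub_eq_zero]
      exact this)
  choose C hC hk using hk
  obtain ⟨r₂, hr₂, hgood⟩ := Metric.eventually_nhds_iff_ball.1
    (hev.and (hsmall.and hΨ.eventually_analyticAt))
  set r := min s (min r₁ r₂) with hr
  have hr0 : 0 < r := by positivity
  have hgood' : ∀ (y : E) (q : TaylorData E (E →L[ℝ] E →L[ℝ] ℝ)), ‖y‖ < r → ‖q‖ < r →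
      (y, r / 2, q) ∈ ball 0 r := fun y q hy hq => by
    rw [mem_ball_zero_iff, Prod.norm_def, Prod.norm_def, Real.norm_of_nonneg (by positivity)]
    exact max_lt hy (max_lt (half_lt_self hr0) hq)
  refine ⟨r / 2, by positivity, r, hr0, C, hC, fun q η hq hη halt hcl =>
    ⟨fun y => Ψ (y, r / 2, q) 1, ?_, fun x hx => ?_⟩⟩
  · simp [(hgood _ (ball_subset_ball (by simp [hr]) (hgood' 0 q (by simpa using hr0) hq))).1.1 rfl]
  rw [mem_ball_zero_iff] at hx
  have hmem := hgood' x q hx hq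
  obtain ⟨⟨-, w, hw0, hw, hwd, hW⟩, hxs, hxan⟩ :=
    hgood _ (ball_subset_ball (by simp [hr]) hmem)
  have hψx : AnalyticAt ℝ (fun a => ev1 (Ψ a)) (x, r / 2, q) := (ev1.analyticAt _).comp hxan
  have hin : HasFDerivAt (fun y => (y, r / 2, q))
      (ContinuousLinearMap.inl ℝ E (ℝ × TaylorData E (E →L[ℝ] E →L[ℝ] ℝ))) x :=
    hasFDerivAt_prodMk_left x (r / 2, q)
  have hρ : HasFDerivAt (fun y => Ψ (y, r / 2, q) 1) ((ev1 ∘L fderiv ℝ Ψ (x, r / 2, q)) ∘L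
      ContinuousLinearMap.inl ℝ E (ℝ × TaylorData E (E →L[ℝ] E →L[ℝ] ℝ))) x :=
    HasFDerivAt.comp (g := fun a => ev1 (Ψ a)) x
      (ev1.hasFDerivAt.comp (x, r / 2, q) hxan.differentiableAt.hasFDerivAt) hin
  refine ⟨ContDiffAt.comp (g := fun a => ev1 (Ψ a)) x hψx.contDiffAt
    (contDiffAt_id.prodMk contDiffAt_const), fun u v => ?_,
    fun k => hk k x (r / 2) q (ball_subset_ball (by simp [hr]) hmem)⟩
  obtain ⟨W₁, hW₁0, hW₁1, hW₁⟩ := hW u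
  obtain ⟨W₂, hW₂0, hW₂1, hW₂⟩ := hW v
  have hd : ∀ t ∈ Icc (0 : ℝ) 1,
      HasDerivAt (fun t => (ω₀ + (r / 2 * t) • η (w t)) (W₁ t) (W₂ t)) 0 t := fun t ht => by
    have hts : (r / 2 * t, w t, q) ∈ ball 0 s := by
      rw [mem_ball_zero_iff, Prod.norm_def, Prod.norm_def,
        Real.norm_of_nonneg (by have := ht.1; positivity), hw ⟨t, ht⟩]
      have hrs : r ≤ s := min_le_left _ _
      refine max_lt (by nlinarith [ht.2]) (max_lt ?_ (hq.trans_le hrs))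
      exact ((Ψ _).norm_coe_le_norm _).trans_lt (mem_ball_zero_iff.1 hxs)
    obtain ⟨han, hspec, h1⟩ := hsz _ hts
    refine hasDerivAt_moser_pullback hω₀' hη halt hcl ?_ han ?_
      (hwd ⟨t, ht⟩) (hW₁ ⟨t, ht⟩) (hW₂ ⟨t, ht⟩)
    · rw [mem_ball_zero_iff, Prod.norm_def, Prod.norm_def] at h1
      exact mem_ball_zero_iff.2 (((le_max_left _ _).trans (le_max_right _ _)).trans_lt h1)
    · have hc : ContinuousAt (fun y : E => (r / 2 * t, y, q)) (w t) := by fun_prop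
      filter_upwards [hc.eventually hspec] with y hy
      rw [hη]
      exact hy
  have hconst := constant_of_has_deriv_right_zero
    (fun t ht => (hd t ht).continuousAt.continuousWithinAt)
    (fun t ht => (hd t (Ico_subset_Icc_self ht)).hasDerivWithinAt) 1 (right_mem_Icc.2 zero_le_one)
  have hw1 : w 1 = Ψ (x, r / 2, q) 1 := hw 1
  rw [hρ.fderiv]
  change (ω₀ + (r / 2) • η (Ψ (x, r / 2, q) 1)) (fderiv ℝ Ψ (x, r / 2, q) (u, 0, 0) 1)
    (fderiv ℝ Ψ (x, r / 2, q) (v, 0, 0) 1) = ω₀ u v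
  rw [← hW₁1, ← hW₂1, ← hw1]
  simpa [hW₁0, hW₂0] using hconst
end

theorem ContDiffOn.exists_weightedEval_eq {E F : Type*} [NormedAddCommGroup E] [NormedSpace ℝ E]
    [NormedAddCommGroup F] [NormedSpace ℝ F] [CompleteSpace F] {f : E → F} {r M δ : ℝ}
    (hf : ContDiffOn ℝ (⊤ : ℕ∞) f (ball 0 r)) (hr : 0 < r) (hδ : 0 < δ)
    (hM : ∀ k : ℕ, ∀ x ∈ ball (0 : E) r, ‖iteratedFDerivWithin ℝ k f (ball 0 r) x‖ ≤ M) :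
    ∃ q : TaylorData E F, ‖q‖ ≤ M / δ ∧ ∀ x ∈ ball (0 : E) r,
      f x = δ • TaylorData.weightedEval E F (fun _ => 1) x q := by
  have h0 : (0 : E) ∈ ball (0 : E) r := mem_ball_self hr
  obtain ⟨q, hq, hqk⟩ := TaylorData.exists_coeffL_eq (E := E) (F := F)
    (a := fun k => δ⁻¹ • iteratedFDerivWithin ℝ k f (ball 0 r) 0) (M := M / δ)
    (div_nonneg ((norm_nonneg _).trans (hM 0 0 h0)) hδ.le) (fun k => by
      rw [norm_smul, norm_inv, Real.norm_of_nonneg hδ.le, div_eq_inv_mul]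
      gcongr
      exact hM k 0 h0)
  refine ⟨q, hq, fun x hx => (hf.hasSum_taylor_of_bound hM hx).unique ?_⟩
  have h := (TaylorData.hasSum_weightedEval (F := F) (c := fun _ => 1) (by simp) x q).const_smul δ
  convert! h using 2 with k
  rw [hqk, one_div, smul_comm, smul_apply, smul_inv_smul₀ hδ.ne']

theorem norm_iteratedFDeriv_add_two_sub_id {E : Type*} [NormedAddCommGroup E] [NormedSpace ℝ E]
    {ρ : E → E} {x : E} (hρ : ∀ᶠ y in 𝓝 x, DifferentiableAt ℝ ρ y) (k : ℕ) :
    ‖iteratedFDeriv ℝ (k + 2) (fun y => ρ y - y) x‖ = ‖iteratedFDeriv ℝ (k + 2) ρ x‖ := by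
  rw [← norm_iteratedFDeriv_fderiv, ← norm_iteratedFDeriv_fderiv, ← norm_iteratedFDeriv_fderiv,
    ← norm_iteratedFDeriv_fderiv]
  have h : fderiv ℝ (fun y => ρ y - y) =ᶠ[𝓝 x] fun y => fderiv ℝ ρ y - ContinuousLinearMap.id ℝ E :=
    hρ.mono fun y hy => (hy.hasFDerivAt.sub (hasFDerivAt_id y)).fderiv
  have h2 : fderiv ℝ (fderiv ℝ (fun y => ρ y - y)) =ᶠ[𝓝 x] fderiv ℝ (fderiv ℝ ρ) :=
    h.fderiv.trans (.of_forall fun y => fderiv_sub_const _)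
  rw [(h2.iteratedFDeriv ℝ k).eq_of_nhds]

/-- The quantitative Moser–Darboux theorem for an arbitrary linear symplectic form on a
finite-dimensional space. -/
theorem exists_darboux_coordinates {E : Type u} [NormedAddCommGroup E] [NormedSpace ℝ E]
    [FiniteDimensional ℝ E] {ω₀ : E →L[ℝ] E →L[ℝ] ℝ} (hω₀ : ω₀.IsInvertible)
    (hω₀' : ∀ u v, ω₀ u v = -ω₀ v u) :
    ∃ ε₀ : ℝ, 0 < ε₀ ∧ ∃ r : ℝ, 0 < r ∧ r ≤ 1 ∧ ∃ C : ℕ → ℝ, (∀ k, 0 < C k) ∧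
      ∀ ε : ℝ, ε ≤ ε₀ → ∀ Ω : E → E →L[ℝ] E →L[ℝ] ℝ,
        ContDiffOn ℝ (⊤ : ℕ∞) Ω (ball 0 1) →
        (∀ x ∈ ball (0 : E) 1, ∀ u v, Ω x u v = -Ω x v u) →
        (∀ x ∈ ball (0 : E) 1, ∀ u v w,
          fderiv ℝ Ω x u v w + fderiv ℝ Ω x v w u + fderiv ℝ Ω x w u v = 0) →
        (∀ k : ℕ, ∀ x ∈ ball (0 : E) 1,
          ‖iteratedFDerivWithin ℝ k (fun x => Ω x - ω₀) (ball 0 1) x‖ ≤ ε) →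
        ∃ ρ : E → E, ContDiffOn ℝ (⊤ : ℕ∞) ρ (ball 0 r) ∧ InjOn ρ (ball 0 r) ∧
          MapsTo ρ (ball 0 r) (ball 0 1) ∧ ρ 0 = 0 ∧ ∀ x ∈ ball (0 : E) r,
            (∀ u v, Ω (ρ x) (fderiv ℝ ρ x u) (fderiv ℝ ρ x v) = ω₀ u v) ∧
            ‖fderiv ℝ ρ x - ContinuousLinearMap.id ℝ E‖ ≤ C 1 * ε ∧
            ∀ k, 2 ≤ k → ‖iteratedFDeriv ℝ k ρ x‖ ≤ C k * ε := by
  obtain ⟨δ, hδ, r, hr, C, hC, h⟩ := exists_moser_diffeo hω₀ hω₀'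
  have hC0 := hC 0
  have hC1 := hC 1
  refine ⟨min (δ * (r / 2)) (min (δ * (C 0)⁻¹ / 3) (δ * (C 1)⁻¹ / 2)), by positivity,
    min r 2⁻¹, by positivity, (min_le_right _ _).trans (by norm_num), fun k => C k / δ,
    fun k => div_pos (hC k) hδ, fun ε hε Ω hΩ halt hcl hM => ?_⟩
  obtain ⟨q, hq, hqΩ⟩ := (hΩ.sub contDiffOn_const).exists_weightedEval_eq one_pos hδ hM
  set η : E → E →L[ℝ] E →L[ℝ] ℝ := fun x => TaylorData.weightedEval E _ (fun _ => 1) x q with hη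
  have hΩη : ∀ x ∈ ball (0 : E) 1, Ω x = ω₀ + δ • η x := fun x hx => by
    rw [← hqΩ x hx]; abel
  have hηΩ : ∀ x ∈ ball (0 : E) 1, η x = δ⁻¹ • (Ω x - ω₀) := fun x hx => by
    rw [hqΩ x hx, inv_smul_smul₀ hδ.ne']
  have hε' : ∀ k, C k * ‖q‖ ≤ C k / δ * ε := fun k =>
    (mul_le_mul_of_nonneg_left hq (hC k).le).trans_eq (by ring)
  have hq1 : ‖q‖ < r := by
    have : ε / δ ≤ r / 2 := (div_le_iff₀' hδ).2 (hε.trans (min_le_left _ _))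
    linarith
  have hq2 : C 0 * ‖q‖ ≤ 1 / 3 := by
    refine (hε' 0).trans ?_
    have h1 := hε.trans ((min_le_right _ _).trans (min_le_left _ _))
    calc C 0 / δ * ε ≤ C 0 / δ * (δ * (C 0)⁻¹ / 3) := by gcongr
      _ = 1 / 3 := by field_simp
  have hq3 : C 1 * ‖q‖ ≤ 1 / 2 := by
    refine (hε' 1).trans ?_
    have h1 := hε.trans ((min_le_right _ _).trans (min_le_right _ _))
    calc C 1 / δ * ε ≤ C 1 / δ * (δ * (C 1)⁻¹ / 2) := by gcongr
      _ = 1 / 2 := by field_simp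
  obtain ⟨ρ, hρ0, hρ⟩ := h q η hq1 hη
    (fun x hx u v => by
      rw [hηΩ x hx]
      simp [halt x hx u v, hω₀' u v]
      ring)
    (fun x hx u v w => by
      have hd : DifferentiableAt ℝ Ω x :=
        (hΩ.contDiffAt (isOpen_ball.mem_nhds hx)).differentiableAt (by simp)
      have h1 : HasFDerivAt η (δ⁻¹ • fderiv ℝ Ω x) x :=
        ((hd.hasFDerivAt.sub_const ω₀).const_smul δ⁻¹).congr_of_eventuallyEq
          (Filter.eventually_of_mem (isOpen_ball.mem_nhds hx) hηΩ)
      rw [h1.fderiv]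
      have := hcl x hx u v w
      simp only [smul_apply, smul_eq_mul]
      linear_combination δ⁻¹ * this)
  have hsub : ball (0 : E) (min r 2⁻¹) ⊆ ball 0 r := ball_subset_ball (min_le_left _ _)
  have hd : ∀ x ∈ ball (0 : E) r, DifferentiableAt ℝ ρ x := fun x hx =>
    (hρ x hx).1.differentiableAt (by simp)
  have hsd : ∀ x ∈ ball (0 : E) r, HasFDerivAt (fun y => ρ y - y)
      (fderiv ℝ ρ x - ContinuousLinearMap.id ℝ E) x := fun x hx =>
    (hd x hx).hasFDerivAt.sub (hasFDerivAt_id x)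
  have hfd : ∀ x ∈ ball (0 : E) r,
      ‖fderiv ℝ ρ x - ContinuousLinearMap.id ℝ E‖ ≤ C 1 * ‖q‖ := fun x hx => by
    have h1 := (hρ x hx).2.2 1
    rw [← norm_iteratedFDeriv_fderiv, norm_iteratedFDeriv_zero] at h1
    rwa [(hsd x hx).fderiv] at h1
  have hmaps : MapsTo ρ (ball 0 (min r 2⁻¹)) (ball 0 1) := fun x hx => by
    have h1 := (hρ x (hsub hx)).2.2 0
    rw [norm_iteratedFDeriv_zero] at h1
    have h2 : ‖x‖ < 2⁻¹ := (mem_ball_zero_iff.1 hx).trans_le (min_le_right _ _)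
    rw [mem_ball_zero_iff]
    have h3 : ‖ρ x‖ ≤ ‖ρ x - x‖ + ‖x‖ := norm_le_norm_sub_add _ _
    linarith
  refine ⟨ρ, fun x hx => ((hρ x (hsub hx)).1.of_le le_top).contDiffWithinAt, ?_, hmaps, hρ0,
    fun x hx => ⟨?_, (hfd x (hsub hx)).trans (hε' 1), fun k hk => ?_⟩⟩
  · intro x hx y hy hxy
    have h1 := (convex_ball (0 : E) r).norm_image_sub_le_of_norm_hasFDerivWithin_le
      (f := fun z => ρ z - z) (fun z hz => (hsd z hz).hasFDerivWithinAt)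
      (fun z hz => (hfd z hz).trans hq3) (hsub hx) (hsub hy)
    have h2 : ρ y - y - (ρ x - x) = -(y - x) := by rw [hxy]; abel
    simp only [h2, norm_neg] at h1
    have h3 : ‖y - x‖ = 0 := by linarith [norm_nonneg (y - x)]
    exact (sub_eq_zero.1 (norm_eq_zero.1 h3)).symm
  · rw [hΩη _ (hmaps hx)]
    exact (hρ x (hsub hx)).2.1
  · obtain ⟨k, rfl⟩ := Nat.exists_eq_add_of_le' hk
    rw [← norm_iteratedFDeriv_add_two_sub_id
      (Filter.eventually_of_mem (isOpen_ball.mem_nhds (hsub hx)) hd)]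
    exact ((hρ x (hsub hx)).2.2 _).trans (hε' _)

theorem ContinuousLinearMap.isInvertible_of_forall_apply_eq_zero {E : Type*}
    [NormedAddCommGroup E] [NormedSpace ℝ E] [FiniteDimensional ℝ E]
    {ω₀ : E →L[ℝ] E →L[ℝ] ℝ} (h : ∀ u, (∀ v, ω₀ u v = 0) → u = 0) :
    ω₀.IsInvertible := by
  have hinj : Function.Injective ω₀.toLinearMap :=
    (injective_iff_map_eq_zero _).2 fun u hu => h u fun v => by
      simpa using congrArg (fun T : E →L[ℝ] ℝ => T v) hu
  have hrank : Module.finrank ℝ E = Module.finrank ℝ (E →L[ℝ] ℝ) := by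
    rw [← (LinearMap.toContinuousLinearMap (𝕜 := ℝ) (E := E) (F' := ℝ)).finrank_eq]
    exact Subspace.dual_finrank_eq.symm
  exact ⟨(LinearEquiv.ofInjectiveOfFinrankEq ω₀.toLinearMap hinj hrank).toContinuousLinearEquiv, by
    ext; rfl⟩

theorem UniqueDiffOn.norm_iteratedFDerivWithin_succ_sub_const {E F : Type*}
    [NormedAddCommGroup E] [NormedSpace ℝ E] [NormedAddCommGroup F] [NormedSpace ℝ F]
    {f : E → F} {s : Set E} {x : E} (hs : UniqueDiffOn ℝ s) (hx : x ∈ s) (c : F) (k : ℕ) :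
    ‖iteratedFDerivWithin ℝ (k + 1) (fun y => f y - c) s x‖ =
      ‖iteratedFDerivWithin ℝ (k + 1) f s x‖ := by
  rw [← norm_iteratedFDerivWithin_fderivWithin hs hx,
    ← norm_iteratedFDerivWithin_fderivWithin hs hx]
  congr 2
  exact funext fun y => fderivWithin_sub_const c

end

/-- Quantitative Moser–Darboux theorem on the ball: there are constants `ε₀`, `r` and
`C_k` depending only on `n` such that any smooth closed 2-form `ω` on the unit ball
of `ℂⁿ ≅ ℝ²ⁿ` with `ω(0) = ω₀`, `‖ω - ω₀‖ ≤ ε ≤ ε₀` and all derivatives bounded by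
`ε` admits Darboux coordinates: a smooth embedding `ρ : B(0,r) → B` with `ρ(0) = 0`
pulling `ω` back to the standard symplectic form `ω₀`, with `‖Dρ - Id‖ ≤ C₁ε` and
`‖Dᵏρ‖ ≤ C_k ε` for `k ≥ 2`. -/
theorem quantitative_moser_darboux (n : ℕ) (hn : 1 ≤ n)
    (ω₀ : EuclideanSpace ℂ (Fin n) →L[ℝ] EuclideanSpace ℂ (Fin n) →L[ℝ] ℝ)
    (hω₀ : ∀ u v : EuclideanSpace ℂ (Fin n),
      ω₀ u v = ∑ j, ((u j).re * (v j).im - (u j).im * (v j).re)) :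
    ∃ ε₀ : ℝ, 0 < ε₀ ∧ ∃ r : ℝ, 0 < r ∧ r ≤ 1 ∧ ∃ Cc : ℕ → ℝ, (∀ k, 0 < Cc k) ∧
      ∀ ε : ℝ, 0 < ε → ε ≤ ε₀ →
        ∀ ω : EuclideanSpace ℂ (Fin n) →
            (EuclideanSpace ℂ (Fin n) →L[ℝ] EuclideanSpace ℂ (Fin n) →L[ℝ] ℝ),
          ContDiffOn ℝ (⊤ : ℕ∞) ω (ball 0 1) →
          (∀ x ∈ ball (0 : EuclideanSpace ℂ (Fin n)) 1, ∀ u v, ω x u v = - ω x v u) →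
          (∀ x ∈ ball (0 : EuclideanSpace ℂ (Fin n)) 1, ∀ u v w,
            fderivWithin ℝ ω (ball 0 1) x u v w + fderivWithin ℝ ω (ball 0 1) x v w u +
              fderivWithin ℝ ω (ball 0 1) x w u v = 0) →
          ω 0 = ω₀ →
          (∀ x ∈ ball (0 : EuclideanSpace ℂ (Fin n)) 1, ‖ω x - ω₀‖ ≤ ε) →
          (∀ k : ℕ, 1 ≤ k → ∀ x ∈ ball (0 : EuclideanSpace ℂ (Fin n)) 1,
            ‖iteratedFDerivWithin ℝ k ω (ball 0 1) x‖ ≤ ε) →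
          ∃ ρ : EuclideanSpace ℂ (Fin n) → EuclideanSpace ℂ (Fin n),
            ContDiffOn ℝ (⊤ : ℕ∞) ρ (ball 0 r) ∧
            Set.InjOn ρ (ball 0 r) ∧
            Set.MapsTo ρ (ball 0 r) (ball 0 1) ∧
            ρ 0 = 0 ∧
            (∀ x ∈ ball (0 : EuclideanSpace ℂ (Fin n)) r, ∀ u v,
              ω (ρ x) (fderivWithin ℝ ρ (ball 0 r) x u)
                (fderivWithin ℝ ρ (ball 0 r) x v) = ω₀ u v) ∧
            (∀ x ∈ ball (0 : EuclideanSpace ℂ (Fin n)) r,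
              ‖fderivWithin ℝ ρ (ball 0 r) x -
                ContinuousLinearMap.id ℝ (EuclideanSpace ℂ (Fin n))‖ ≤ Cc 1 * ε) ∧
            (∀ k : ℕ, 2 ≤ k → ∀ x ∈ ball (0 : EuclideanSpace ℂ (Fin n)) r,
              ‖iteratedFDerivWithin ℝ k ρ (ball 0 r) x‖ ≤ Cc k * ε) := by
  have hinv : ω₀.IsInvertible := by
    refine ContinuousLinearMap.isInvertible_of_forall_apply_eq_zero fun u hu => ?_
    have h1 := hu (Complex.I • u)
    rw [hω₀] at h1
    ext j
    have h2 : ∀ j, (u j).re * ((Complex.I • u) j).im - (u j).im * ((Complex.I • u) j).re =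
        Complex.normSq (u j) := fun j => by simp [Complex.normSq_apply]
    rw [Finset.sum_congr rfl fun j _ => h2 j,
      Finset.sum_eq_zero_iff_of_nonneg fun j _ => Complex.normSq_nonneg _] at h1
    simpa using h1 j (Finset.mem_univ j)
  have hanti : ∀ u v, ω₀ u v = -ω₀ v u := fun u v => by
    rw [hω₀, hω₀, ← Finset.sum_neg_distrib]
    exact Finset.sum_congr rfl fun j _ => by ring
  obtain ⟨ε₀, hε₀, r, hr, hr1, C, hC, h⟩ := exists_darboux_coordinates hinv hanti
  refine ⟨ε₀, hε₀, r, hr, hr1, C, hC, fun ε _ hε ω hω halt hcl _ hω0 hωk => ?_⟩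
  obtain ⟨ρ, hρ, hinj, hmaps, hρ0, hx⟩ := h ε hε ω hω halt
    (fun x hx => by rw [← fderivWithin_of_isOpen isOpen_ball hx]; exact hcl x hx)
    (fun k x hx => by
      cases k with
      | zero => simpa using hω0 x hx
      | succ k =>
        rw [isOpen_ball.uniqueDiffOn.norm_iteratedFDerivWithin_succ_sub_const hx]
        exact hωk (k + 1) (by simp) x hx)
  refine ⟨ρ, hρ, hinj, hmaps, hρ0, fun x hxr => ?_, fun x hxr => ?_, fun k hk x hxr => ?_⟩
  · rw [fderivWithin_of_isOpen isOpen_ball hxr]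
    exact (hx x hxr).1
  · rw [fderivWithin_of_isOpen isOpen_ball hxr]
    exact (hx x hxr).2.1
  · rw [iteratedFDerivWithin_of_isOpen k isOpen_ball hxr]
    exact (hx x hxr).2.2 k hk
end

section
/- Let E and F be real Banach spaces, let A, B : E → F be bounded linear maps, and let 0 ≤ ε < η. Suppose there exists a bounded linear map S : F → E with A ∘ S = id_F and ‖S‖ ≤ η⁻¹, and suppose ‖B − A‖ ≤ ε. Then B is surjective and there exists a bounded linear map S′ : F → E with B ∘ S′ = id_F and ‖S′‖ ≤ (η − ε)⁻¹. (Perturbation of surjective linear maps with quantitatively bounded right inverse; this underlies the openness of η-transversality.) -/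
/-- Perturbation of surjective bounded linear maps between Banach spaces with
quantitatively bounded right inverse: if `A` has a right inverse of norm `≤ η⁻¹`
and `‖B - A‖ ≤ ε < η`, then `B` is surjective with a right inverse of norm
`≤ (η - ε)⁻¹`. -/
theorem right_inverse_perturbation
    (E F : Type*) [NormedAddCommGroup E] [NormedSpace ℝ E] [CompleteSpace E]
    [NormedAddCommGroup F] [NormedSpace ℝ F] [CompleteSpace F]
    (A B : E →L[ℝ] F) (ε η : ℝ) (hε : 0 ≤ ε) (hεη : ε < η)
    (S : F →L[ℝ] E) (hS : A.comp S = ContinuousLinearMap.id ℝ F)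
    (hSnorm : ‖S‖ ≤ η⁻¹) (hBA : ‖B - A‖ ≤ ε) :
    Function.Surjective B ∧
      ∃ S' : F →L[ℝ] E, B.comp S' = ContinuousLinearMap.id ℝ F ∧
        ‖S'‖ ≤ (η - ε)⁻¹ := by
  have hη : 0 < η := hε.trans_lt hεη
  have hδ : 0 < η - ε := sub_pos.mpr hεη
  let T : F →L[ℝ] F := (A - B).comp S
  have hT : ‖T‖ ≤ ε * η⁻¹ := by
    refine (ContinuousLinearMap.opNorm_comp_le _ _).trans ?_
    rw [norm_sub_rev]
    gcongr
  have hT_lt : ‖T‖ < 1 := hT.trans_lt (by rwa [← div_eq_mul_inv, div_lt_one hη])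
  have hBS : B.comp S = 1 - T := by
    simp only [T, ContinuousLinearMap.sub_comp, hS]
    exact (sub_sub_cancel _ _).symm
  let U : F →L[ℝ] F := ∑' i : ℕ, T ^ i
  have hU : (1 - T) * U = 1 := mul_neg_geom_series T hT_lt
  have hU_norm : ‖U‖ ≤ η * (η - ε)⁻¹ := by
    have hU_eq : U = 1 + T * U := by
      rw [← hU]
      noncomm_ring
    have h_le : ‖U‖ ≤ 1 + ε * η⁻¹ * ‖U‖ := calc
      ‖U‖ = ‖1 + T * U‖ := congrArg norm hU_eq
      _ ≤ ‖(1 : F →L[ℝ] F)‖ + ‖T‖ * ‖U‖ :=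
        (norm_add_le _ _).trans (by gcongr; exact norm_mul_le _ _)
      _ ≤ 1 + ε * η⁻¹ * ‖U‖ := by
        gcongr
        exact ContinuousLinearMap.norm_id_le
    rw [← div_eq_mul_inv, le_div_iff₀ hδ]
    have h_mul := mul_le_mul_of_nonneg_left h_le hη.le
    have h_cancel : η * (1 + ε * η⁻¹ * ‖U‖) = η + ε * ‖U‖ := by field_simp
    linarith
  have h_right : B.comp (S.comp U) = ContinuousLinearMap.id ℝ F := by
    rw [← ContinuousLinearMap.comp_assoc, hBS]
    exact hU
  refine ⟨fun y => ⟨S.comp U y, DFunLike.congr_fun h_right y⟩, S.comp U, h_right, ?_⟩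
  calc
    ‖S.comp U‖ ≤ ‖S‖ * ‖U‖ := ContinuousLinearMap.opNorm_comp_le _ _
    _ ≤ η⁻¹ * (η * (η - ε)⁻¹) := by gcongr
    _ = (η - ε)⁻¹ := inv_mul_cancel_left₀ hη.ne' _
end
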